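/- Every irreducible generically free PGL_n-variety X is birationally isomorphic, as a PGL_n-variety, to an irreducible n-variety in U_{m,n} for some m ≥ 2. -/

import Mathlib

set_option linter.unusedSectionVars false

noncomputable section

universe u

-- Throughout, `k` is an algebraically closed base field of characteristic zero.
variable (k : Type) [Field k] [IsAlgClosed k] [CharZero k]

/-- Index type for the `m·n²` commuting variables `x_{ij}^{(h)}`. -/
abbrev MIdx (n m : ℕ) := Fin m × Fin n × Fin n

/-- The commutative polynomial ring `k[x_{ij}^{(h)}]`. -/
abbrev PolyRing (n m : ℕ) := MvPolynomial (MIdx n m) k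

/-- Matrices over the polynomial ring `k[x_{ij}^{(h)}]`. -/
abbrev MatPoly (n m : ℕ) := Matrix (Fin n) (Fin n) (PolyRing k n m)

/-- The space `(M_n)^m` of `m`-tuples of `n×n` matrices over `k`. -/
abbrev MTuple (n m : ℕ) := Fin m → Matrix (Fin n) (Fin n) k

/-- The `h`-th generic `n×n` matrix `X_h = (x_{ij}^{(h)})`. -/
def genericMatrix (n m : ℕ) (h : Fin m) : MatPoly k n m :=
  Matrix.of fun i j => MvPolynomial.X (h, i, j)

/-- `G_{m,n}`, the algebra of `m` generic `n×n` matrices: the `k`-subalgebra of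
`M_n(k[x_{ij}^{(h)}])` generated by the generic matrices. -/
def GMN (n m : ℕ) : Subalgebra k (MatPoly k n m) :=
  Algebra.adjoin k (Set.range (genericMatrix k n m))

/-- Evaluation of the commuting variables at a point `a ∈ (M_n)^m`. -/
def polyEval {n m : ℕ} (a : MTuple k n m) : PolyRing k n m →ₐ[k] k :=
  MvPolynomial.aeval fun x : MIdx n m => a x.1 x.2.1 x.2.2

/-- Evaluation of matrix-valued polynomials at a point `a ∈ (M_n)^m`; under this
map an element of `G_{m,n}` (or `T_{m,n}`) becomes a `PGL_n`-equivariant polynomial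
map `(M_n)^m → M_n`. -/
def evalMat {n m : ℕ} (a : MTuple k n m) :
    MatPoly k n m →ₐ[k] Matrix (Fin n) (Fin n) k :=
  (polyEval k a).mapMatrix

/-- The scalar matrix `tr(p)·1 ∈ M_n(k[x_{ij}^{(h)}])`. -/
def traceScalar {n m : ℕ} (p : MatPoly k n m) : MatPoly k n m :=
  algebraMap (PolyRing k n m) (MatPoly k n m) (Matrix.trace p)

/-- `T_{m,n}`, the trace ring of `G_{m,n}`: the `k`-algebra generated inside
`M_n(k[x_{ij}^{(h)}])` by `G_{m,n}` together with the traces of its elements. -/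
def TMN (n m : ℕ) : Subalgebra k (MatPoly k n m) :=
  Algebra.adjoin k ((GMN k n m : Set (MatPoly k n m)) ∪
    (traceScalar k '' (GMN k n m : Set (MatPoly k n m))))

lemma GMN_le_TMN (n m : ℕ) : GMN k n m ≤ TMN k n m :=
  fun _ hx => Algebra.subset_adjoin (Or.inl hx)

/-- The inclusion `G_{m,n} → T_{m,n}`. -/
def inclGT (n m : ℕ) : ↥(GMN k n m) →+* ↥(TMN k n m) :=
  (Subalgebra.inclusion (GMN_le_TMN k n m) : ↥(GMN k n m) →ₐ[k] ↥(TMN k n m)).toRingHom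

/-- `U_{m,n}`: the set of `m`-tuples of `n×n` matrices generating `M_n` as a
`k`-algebra. -/
def genTuples (n m : ℕ) : Set (MTuple k n m) :=
  {a | Algebra.adjoin k (Set.range a) = ⊤}

/-- Simultaneous conjugation of an `m`-tuple by `g ∈ GL_n(k)`; since scalar
matrices act trivially, this is the `PGL_n`-action on `(M_n)^m`. -/
def conjAct {n m : ℕ} (g : GL (Fin n) k) (a : MTuple k n m) : MTuple k n m :=
  fun i =>
    (g : Matrix (Fin n) (Fin n) k) * a i * ((g⁻¹ : GL (Fin n) k) : Matrix (Fin n) (Fin n) k)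

/-- Zariski closed subsets of `(M_n)^m`. -/
def IsZClosed {n m : ℕ} (C : Set (MTuple k n m)) : Prop :=
  ∃ S : Set (PolyRing k n m), C = {a | ∀ p ∈ S, polyEval k a p = 0}

/-- `X` is an `n`-variety: a closed `PGL_n`-invariant subvariety of `U_{m,n}`,
i.e. `X = X̄ ∩ U_{m,n}` where `X̄` is the Zariski closure of `X` in `(M_n)^m`. -/
def IsNVariety {n m : ℕ} (X : Set (MTuple k n m)) : Prop :=
  X ⊆ genTuples k n m ∧
  (∀ g : GL (Fin n) k, ∀ a ∈ X, conjAct k g a ∈ X) ∧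
  ∃ C, IsZClosed k C ∧ X = C ∩ genTuples k n m

/-- Irreducibility of a subset of `(M_n)^m` with respect to the Zariski topology. -/
def IsIrredSubset {n m : ℕ} (X : Set (MTuple k n m)) : Prop :=
  X.Nonempty ∧ ∀ C₁ C₂ : Set (MTuple k n m), IsZClosed k C₁ → IsZClosed k C₂ →
    X ⊆ C₁ ∪ C₂ → X ⊆ C₁ ∨ X ⊆ C₂

/-- The zero locus in `U_{m,n}` of a set of matrix-valued polynomials. -/
def zeroLocus {n m : ℕ} (S : Set (MatPoly k n m)) : Set (MTuple k n m) :=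
  {a | a ∈ genTuples k n m ∧ ∀ p ∈ S, evalMat k a p = 0}

/-- The zero locus in `U_{m,n}` of a two-sided ideal of a subalgebra `A` of
`M_n(k[x_{ij}^{(h)}])` (such as `G_{m,n}` or `T_{m,n}`). -/
def zeroLocusI {n m : ℕ} {A : Subalgebra k (MatPoly k n m)} (J : TwoSidedIdeal ↥A) :
    Set (MTuple k n m) :=
  {a | a ∈ genTuples k n m ∧ ∀ p : ↥A, p ∈ J → evalMat k a (p : MatPoly k n m) = 0}

/-- The vanishing (two-sided) ideal of a subset `X ⊆ (M_n)^m` in a subalgebra `A`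
of `M_n(k[x_{ij}^{(h)}])`; for `A = G_{m,n}` this is `I(X)`, for `A = T_{m,n}`
this is `I_T(X)`. -/
def vanishIdeal {n m : ℕ} (A : Subalgebra k (MatPoly k n m)) (X : Set (MTuple k n m)) :
    TwoSidedIdeal ↥A :=
  TwoSidedIdeal.mk' {p : ↥A | ∀ a ∈ X, evalMat k a (p : MatPoly k n m) = 0}
    (fun a _ => by simp)
    (fun {p q} hp hq a ha => by
      have : ((p + q : ↥A) : MatPoly k n m) = (p : MatPoly k n m) + q := rfl
      simp [this, map_add, hp a ha, hq a ha])
    (fun {p} hp a ha => by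
      have : ((-p : ↥A) : MatPoly k n m) = -(p : MatPoly k n m) := rfl
      simp [this, map_neg, hp a ha])
    (fun {p q} hq a ha => by
      have : ((p * q : ↥A) : MatPoly k n m) = (p : MatPoly k n m) * q := rfl
      simp [this, map_mul, hq a ha])
    (fun {p q} hp a ha => by
      have : ((p * q : ↥A) : MatPoly k n m) = (p : MatPoly k n m) * q := rfl
      simp [this, map_mul, hp a ha])

/-- Restriction: a matrix-valued polynomial gives an `M_n`-valued function on `X`. -/
def restrictTo {n m : ℕ} (X : Set (MTuple k n m)) :
    MatPoly k n m →ₐ[k] (X → Matrix (Fin n) (Fin n) k) :=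
  Pi.algHom k _ fun a => evalMat k a.val

/-- The PI-coordinate ring `k_n[X] = G_{m,n}/I(X)`, realized concretely as the
algebra of all restrictions to `X` of elements of `G_{m,n}` (i.e. of
`PGL_n`-equivariant morphisms `X → M_n` coming from `G_{m,n}`). -/
def coordRing {n m : ℕ} (X : Set (MTuple k n m)) :
    Subalgebra k (X → Matrix (Fin n) (Fin n) k) :=
  (GMN k n m).map (restrictTo k X)

/-- The ring `T_{m,n}/I_T(X)`, realized concretely as the algebra of all
restrictions to `X` of elements of `T_{m,n}`. -/
def coordTraceRing {n m : ℕ} (X : Set (MTuple k n m)) :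
    Subalgebra k (X → Matrix (Fin n) (Fin n) k) :=
  (TMN k n m).map (restrictTo k X)

/-- A ring is prime if it is nonzero and `a·R·b = 0` implies `a = 0` or `b = 0`. -/
def IsPrimeRing (R : Type u) [Ring R] : Prop :=
  Nontrivial R ∧ ∀ a b : R, (∀ x : R, a * x * b = 0) → a = 0 ∨ b = 0

/-- `Q` is a central simple algebra of degree `n`: a simple ring whose center is a
field, and which has dimension `n²` over its center. -/
def IsCSAOfDegree (n : ℕ) (Q : Type u) [Ring Q] : Prop :=
  IsSimpleRing Q ∧
  ∃ (K : Type u) (_ : Field K) (_ : Algebra K Q),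
    (algebraMap K Q).range = Subring.center Q ∧ Module.finrank K Q = n ^ 2

/-- A (prime PI-) ring `R` has PI-degree `n` if its total ring of fractions — the
central localization of `R` at its nonzero central elements — is a central simple
algebra of degree `n`. -/
def HasPIDegree (n : ℕ) (R : Type u) [Ring R] : Prop :=
  ∃ (Q : Type u) (_ : Ring Q) (f : R →+* Q),
    Function.Injective f ∧
    (∀ c ∈ Subring.center R, c ≠ 0 → IsUnit (f c)) ∧
    (∀ q : Q, ∃ r : R, ∃ c ∈ Subring.center R, c ≠ 0 ∧ q * f c = f r) ∧
    IsCSAOfDegree n Q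

/-- The quotient of a ring by a two-sided ideal. -/
abbrev idealQuot {R : Type u} [Ring R] (J : TwoSidedIdeal R) : Type u := J.ringCon.Quotient

/-- `Spec_n(R)`: the set of prime (two-sided) ideals `J` of `R` such that `R/J` is a
prime ring of PI-degree `n`. -/
def SpecN (n : ℕ) (R : Type u) [Ring R] : Set (TwoSidedIdeal R) :=
  {J | IsPrimeRing (idealQuot J) ∧ HasPIDegree n (idealQuot J)}

/-- A regular map of `n`-varieties `X → Y ⊆ U_{l,n}`: a map of the form
`a ↦ (f₁(a), …, f_l(a))` with each `f_i ∈ k_n[X]`, i.e. each component is the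
restriction to `X` of an element of `G_{m,n}`. -/
def IsRegMapOn {n m l : ℕ} (X : Set (MTuple k n m)) (Y : Set (MTuple k n l))
    (φ : MTuple k n m → MTuple k n l) : Prop :=
  (∀ a ∈ X, φ a ∈ Y) ∧
  ∃ F : Fin l → MatPoly k n m, (∀ i, F i ∈ GMN k n m) ∧
    ∀ a ∈ X, ∀ i, φ a i = evalMat k a (F i)

/-- `X` and `Y` are isomorphic `n`-varieties: there are mutually inverse regular
maps of `n`-varieties between them. -/
def NIsomorphic {n m l : ℕ} (X : Set (MTuple k n m)) (Y : Set (MTuple k n l)) : Prop :=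
  ∃ (φ : MTuple k n m → MTuple k n l) (ψ : MTuple k n l → MTuple k n m),
    IsRegMapOn k X Y φ ∧ IsRegMapOn k Y X ψ ∧
    (∀ a ∈ X, ψ (φ a) = a) ∧ (∀ b ∈ Y, φ (ψ b) = b)


/-- The scalar matrix `c·1` as an element of `GL_n(k)`. -/
def scalarGL {n : ℕ} (c : kˣ) : GL (Fin n) k :=
  Units.map (algebraMap k (Matrix (Fin n) (Fin n) k)).toMonoidHom c

/-- Zariski closed subsets of affine `N`-space over `k`. -/
def IsAffClosed (N : ℕ) (C : Set (Fin N → k)) : Prop :=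
  ∃ S : Set (MvPolynomial (Fin N) k), C = {v | ∀ p ∈ S, MvPolynomial.eval v p = 0}

/-- Irreducibility of a subset of affine `N`-space in the Zariski topology. -/
def IsAffIrred (N : ℕ) (Y : Set (Fin N → k)) : Prop :=
  Y.Nonempty ∧ ∀ C₁ C₂ : Set (Fin N → k), IsAffClosed k N C₁ → IsAffClosed k N C₂ →
    Y ⊆ C₁ ∪ C₂ → Y ⊆ C₁ ∨ Y ⊆ C₂

/-- A `PGL_n`-variety: an (affine) algebraic variety over `k`, i.e. a Zariski
closed subset of some `k^N`, together with an algebraic (regular) action of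
`GL_n(k)` on it in which scalar matrices act trivially — that is, an algebraic
action of `PGL_n`.  The action is algebraic in the sense that its coordinates
are given by polynomials in the entries of `g`, the entries of `g⁻¹` and the
coordinates of the point. -/
structure PGLnVar (n : ℕ) where
  N : ℕ
  carrier : Set (Fin N → k)
  closed : IsAffClosed k N carrier
  act : GL (Fin n) k → (Fin N → k) → (Fin N → k)
  actP : Fin N → MvPolynomial ((Fin n × Fin n) ⊕ ((Fin n × Fin n) ⊕ Fin N)) k
  act_eval : ∀ (g : GL (Fin n) k) (v : Fin N → k) (i : Fin N),
    act g v i = MvPolynomial.eval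
      (Sum.elim (fun ab => (g : Matrix (Fin n) (Fin n) k) ab.1 ab.2)
        (Sum.elim (fun ab => ((g⁻¹ : GL (Fin n) k) : Matrix (Fin n) (Fin n) k) ab.1 ab.2) v))
      (actP i)
  act_mem : ∀ g : GL (Fin n) k, ∀ v ∈ carrier, act g v ∈ carrier
  act_one : ∀ v ∈ carrier, act 1 v = v
  act_mul : ∀ g h : GL (Fin n) k, ∀ v ∈ carrier, act (g * h) v = act g (act h v)
  scalar_trivial : ∀ c : kˣ, ∀ v ∈ carrier, act (scalarGL k c) v = v

/-- The `PGL_n`-variety `V` is irreducible. -/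
def PGLnVar.IsIrr {n : ℕ} (V : PGLnVar k n) : Prop := IsAffIrred k V.N V.carrier

/-- The `PGL_n`-action on `V` is generically free: the stabilizer in `PGL_n` of
every point in a dense open subset is trivial, i.e. its stabilizer in `GL_n`
consists of scalar matrices. -/
def PGLnVar.IsGenericallyFree {n : ℕ} (V : PGLnVar k n) : Prop :=
  ∃ C : Set (Fin V.N → k), IsAffClosed k V.N C ∧ ¬ V.carrier ⊆ C ∧
    ∀ v ∈ V.carrier, v ∉ C →
      ∀ g : GL (Fin n) k, V.act g v = v → ∃ c : kˣ, g = scalarGL k c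

/-- The value at `v ∈ V ⊆ k^N` of the rational map `V ⇢ (M_n)^m` with matrix
entries `p_i(v)/q(v)`. -/
def affRatVal {N n m : ℕ} (p : Fin m → Matrix (Fin n) (Fin n) (MvPolynomial (Fin N) k))
    (q : MvPolynomial (Fin N) k) (v : Fin N → k) : MTuple k n m :=
  fun i => Matrix.of fun r s => (MvPolynomial.eval v q)⁻¹ * MvPolynomial.eval v (p i r s)

/-- The value at `x ∈ X ⊆ (M_n)^m` of the rational map `X ⇢ k^N` with
coordinates `u_j(x)/d(x)`. -/
def matRatVal {N n m : ℕ} (u : Fin N → PolyRing k n m) (d : PolyRing k n m)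
    (x : MTuple k n m) : Fin N → k :=
  fun j => (polyEval k x d)⁻¹ * polyEval k x (u j)

section
open scoped TensorProduct

theorem aux_two_homs.{w1, w2} {L0 : Type w1} {L : Type w2} [Field L0] [Field L] [CharZero L0] [Algebra L0 L] (s : L)
    (hs : s ∉ (algebraMap L0 L).range) :
    ∃ (D : Type w1) (_ : Field D) (_ : Algebra L0 D)
      (α β : Algebra.adjoin L0 {s} →ₐ[L0] D),
      α ⟨s, Algebra.subset_adjoin rfl⟩ ≠ β ⟨s, Algebra.subset_adjoin rfl⟩ := by
  by_cases hi : IsIntegral L0 s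
  · let D := AlgebraicClosure L0
    have hsep : (minpoly L0 s).Separable := (minpoly.irreducible hi).separable
    have hsp : ((minpoly L0 s).map (algebraMap L0 D)).Splits := IsAlgClosed.splits _
    have hcard := Polynomial.card_rootSet_eq_natDegree hsep hsp
    have h2 : 1 < (minpoly L0 s).natDegree := by
      by_contra hlt
      have h1 := minpoly.natDegree_pos hi
      have : (minpoly L0 s).natDegree = 1 := by omega
      exact hs (minpoly.natDegree_eq_one_iff.1 this)
    rw [← hcard] at h2
    obtain ⟨x, y, hxy⟩ := Fintype.one_lt_card_iff.1 h2
    have hx := Polynomial.aeval_eq_zero_of_mem_rootSet x.2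
    have hy := Polynomial.aeval_eq_zero_of_mem_rootSet y.2
    refine ⟨D, inferInstance, inferInstance,
      Algebra.adjoin.liftSingleton L0 s x.1 hx, Algebra.adjoin.liftSingleton L0 s y.1 hy, ?_⟩
    intro h
    apply hxy
    apply Subtype.ext
    have he : AlgEquiv.adjoinSingletonEquivAdjoinRootMinpoly L0 s
        ⟨s, Algebra.subset_adjoin rfl⟩ = AdjoinRoot.root _ := by
      rw [← AlgEquiv.eq_symm_apply]
      apply Subtype.ext
      simp
    have hr : ∀ (z : D) (hz : Polynomial.aeval z (minpoly L0 s) = 0),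
        Algebra.adjoin.liftSingleton L0 s z hz ⟨s, Algebra.subset_adjoin rfl⟩ = z := by
      intro z hz
      change AdjoinRoot.liftAlgHom _ _ z hz (AlgEquiv.adjoinSingletonEquivAdjoinRootMinpoly L0 s
        ⟨s, Algebra.subset_adjoin rfl⟩) = z
      rw [he]
      exact AdjoinRoot.liftAlgHom_root ..
    rw [hr, hr] at h
    exact h
  · have hinj : Function.Injective (Polynomial.aeval s : Polynomial L0 →ₐ[L0] L) := by
      have : Transcendental L0 s := fun h => hi h.isIntegral
      exact transcendental_iff_injective.1 this
    let e : Polynomial L0 ≃ₐ[L0] Algebra.adjoin L0 {s} :=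
      (AlgEquiv.ofInjective _ hinj).trans
        (Subalgebra.equivOfEq _ _ (Algebra.adjoin_singleton_eq_range_aeval L0 s).symm)
    have he : e.symm ⟨s, Algebra.subset_adjoin rfl⟩ = Polynomial.X := by
      rw [AlgEquiv.symm_apply_eq]
      apply Subtype.ext
      simp [e]
    refine ⟨L0, inferInstance, inferInstance, (Polynomial.aeval 0).comp e.symm.toAlgHom,
      (Polynomial.aeval 1).comp e.symm.toAlgHom, ?_⟩
    simp [he]

theorem aux_not_nilpotent {L0 L : Type*} [Field L0] [Field L] [CharZero L0] [Algebra L0 L] (s : L)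
    (hs : s ∉ (algebraMap L0 L).range) :
    ¬ IsNilpotent (s ⊗ₜ[L0] (1 : L) - (1 : L) ⊗ₜ[L0] s) := by
  obtain ⟨D, _, _, α, β, hab⟩ := aux_two_homs s hs
  let A := Algebra.adjoin L0 {s}
  let j : A ⊗[L0] A →ₐ[L0] L ⊗[L0] L := Algebra.TensorProduct.map A.val A.val
  have hj : Function.Injective j := by
    have := TensorProduct.map_injective_of_flat_flat (A.val.toLinearMap) (A.val.toLinearMap)
      Subtype.val_injective Subtype.val_injective
    exact this
  let s' : A := ⟨s, Algebra.subset_adjoin rfl⟩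
  have e : j (s' ⊗ₜ[L0] (1 : A) - (1 : A) ⊗ₜ[L0] s') = s ⊗ₜ[L0] (1 : L) - (1 : L) ⊗ₜ[L0] s := by
    simp [j, s']
  rw [← e, IsNilpotent.map_iff hj]
  intro h
  have := h.map (Algebra.TensorProduct.productMap α β)
  simp [sub_eq_zero] at this
  exact hab this

theorem aux_nullst {k : Type} [Field k] [IsAlgClosed k] {ι : Type} [Finite ι] {Ω : Type*} [CommRing Ω]
    [Nontrivial Ω] [Algebra k Ω] (ω : ι → Ω) :
    ∃ c : ι → k, ∀ P : MvPolynomial ι k, MvPolynomial.aeval ω P = 0 → MvPolynomial.eval c P = 0 := by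
  have h : RingHom.ker (MvPolynomial.aeval ω : MvPolynomial ι k →ₐ[k] Ω) ≠ ⊤ := RingHom.ker_ne_top _
  obtain ⟨M, hM, hle⟩ := Ideal.exists_le_maximal _ h
  obtain ⟨x, hx⟩ := MvPolynomial.isMaximal_iff_eq_vanishingIdeal_singleton.1 hM
  refine ⟨x, fun P hP => ?_⟩
  have : P ∈ M := hle hP
  rw [hx] at this
  simpa using this

/-- specialization lemma -/
theorem aux_spec {k K K' S : Type*} [Field k] [Field K] [Field K'] [CommRing S] [Algebra k S]
    [Algebra k K] [Algebra k K'] (θ : S →ₐ[k] K) (a : S →ₐ[k] K') (hle : ∀ s, θ s = 0 → a s = 0)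
    {σ : Type*} (x : σ → K) (y : σ → K')
    (hxy : ∀ i, ∃ s t, a t ≠ 0 ∧ θ t * x i = θ s ∧ a t * y i = a s) (r : MvPolynomial σ k)
    (h0 : MvPolynomial.aeval x r = 0) : MvPolynomial.aeval y r = 0 := by
  have key : ∃ s t, a t ≠ 0 ∧ θ t * MvPolynomial.aeval x r = θ s ∧
      a t * MvPolynomial.aeval y r = a s := by
    clear h0
    induction r using MvPolynomial.induction_on with
    | C c => exact ⟨algebraMap k S c, 1, by simp, by simp, by simp⟩
    | add p q hp hq =>
      obtain ⟨s, t, ht, h1, h2⟩ := hp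
      obtain ⟨s', t', ht', h1', h2'⟩ := hq
      refine ⟨s * t' + s' * t, t * t', ?_, ?_, ?_⟩
      · rw [map_mul]; exact mul_ne_zero ht ht'
      · simp only [map_mul, map_add, ← h1, ← h1']; ring
      · simp only [map_mul, map_add, ← h2, ← h2']; ring
    | mul_X p i hp =>
      obtain ⟨s, t, ht, h1, h2⟩ := hp
      obtain ⟨s', t', ht', h1', h2'⟩ := hxy i
      refine ⟨s * s', t * t', ?_, ?_, ?_⟩
      · rw [map_mul]; exact mul_ne_zero ht ht'
      · simp only [map_mul, MvPolynomial.aeval_X, ← h1, ← h1']; ring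
      · simp only [map_mul, MvPolynomial.aeval_X, ← h2, ← h2']; ring
  obtain ⟨s, t, ht, h1, h2⟩ := key
  rw [h0, mul_zero] at h1
  rw [hle s h1.symm] at h2
  exact (mul_eq_zero.1 h2).resolve_left ht

end

section AbsAlg
variable {H K : Type} [Group H] [Field K] [MulSemiringAction H K]

/-- orbit function -/
def tf (H : Type) {K : Type} [Group H] [Field K] [MulSemiringAction H K] (x : K) : H → K :=
  fun g => g • x

/-- twisted action -/
def tw (h : H) (ψ : H → K) : H → K := fun g => h • ψ (h⁻¹ * g)

theorem tf_mul (x y : K) : tf H (x * y) = tf H x * tf H y := by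
  funext g; simp [tf]

theorem tf_linInd {b : Set K} (hb : LinearIndepOn (FixedPoints.subfield H K) id b) :
    LinearIndepOn K (tf H : K → (H → K)) b := by
  rw [linearIndepOn_iff_linearIndepOn_finset]
  intro t ht
  have := FixedPoints.linearIndependent_smul_of_linearIndependent H K (s := t) (hb.mono ht)
  exact this

theorem tf_span (b : Set K) (x : K) (hx : x ∈ Submodule.span (FixedPoints.subfield H K) b) :
    tf H x ∈ Submodule.span K (tf H '' b) := by
  induction hx using Submodule.span_induction with
  | mem x h => exact Submodule.subset_span ⟨x, h, rfl⟩
  | zero =>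
    have : tf H (0 : K) = 0 := by funext g; simp [tf]
    rw [this]; exact zero_mem _
  | add x y _ _ hx hy =>
    have : tf H (x + y) = tf H x + tf H y := by funext g; simp [tf]
    rw [this]; exact add_mem hx hy
  | smul a x _ hx =>
    have : tf H (a • x) = (a : K) • tf H x := by
      funext g
      have h1 : g • (a : K) = a := a.2 g
      simp [tf, Subfield.smul_def, h1]
    rw [this]; exact Submodule.smul_mem _ _ hx

theorem tf_descent (W : Submodule (FixedPoints.subfield H K) K) (s : K)
    (hs : tf H s ∈ Submodule.span K (tf H '' (W : Set K))) : s ∈ W := by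
  obtain ⟨b, hbW, hspan, hb⟩ := exists_linearIndependent (FixedPoints.subfield H K) (W : Set K)
  rw [Submodule.span_eq] at hspan
  by_contra hsW
  have hsb : s ∉ Submodule.span (FixedPoints.subfield H K) b := by rwa [hspan]
  have hb' : LinearIndepOn (FixedPoints.subfield H K) id (insert s b) :=
    LinearIndepOn.insert hb (by simpa using hsb)
  have hK := tf_linInd hb'
  have hnot : s ∉ b := fun h => hsb (Submodule.subset_span h)
  rw [linearIndepOn_insert hnot] at hK
  apply hK.2
  refine (Submodule.span_le.2 ?_) hs
  rintro _ ⟨x, hx, rfl⟩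
  exact tf_span b x (by rw [hspan]; exact hx)

theorem span_mul_tf (x : K) (ψ : H → K) (hψ : ψ ∈ Submodule.span K (Set.range (tf H : K → H → K))) :
    tf H x * ψ ∈ Submodule.span K (Set.range (tf H : K → H → K)) := by
  induction hψ using Submodule.span_induction with
  | mem y h => 
    obtain ⟨y, rfl⟩ := h
    rw [← tf_mul]; exact Submodule.subset_span ⟨_, rfl⟩
  | zero => simp
  | add x y _ _ hx hy => rw [mul_add]; exact add_mem hx hy
  | smul a x _ hx => rw [mul_smul_comm]; exact Submodule.smul_mem _ _ hx

theorem tw_lc {ι : Type} (β : ι → K) (h : H) (c : ι →₀ K) :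
    tw h (Finsupp.linearCombination K (fun i => tf H (β i)) c) =
      Finsupp.linearCombination K (fun i => tf H (β i))
        (c.mapRange (fun x => h • x) (smul_zero h)) := by
  funext g
  rw [Finsupp.linearCombination_apply, Finsupp.linearCombination_apply,
    Finsupp.sum_mapRange_index (by simp)]
  simp [tw, Finsupp.sum, Finset.smul_sum, smul_mul', tf, smul_smul]

variable {ι : Type} [Fintype ι] [DecidableEq ι]

theorem tw_T (T : H → Matrix ι ι K) (hmul : ∀ g h : H, T (g * h) = T g * T h)
    (hfix : ∀ (g h : H) i j, g • T h i j = T h i j) (h : H) (i j : ι) :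
    tw h (fun g => T g i j) = ∑ l, T h⁻¹ i l • (fun g => T g l j) := by
  funext g
  simp only [tw, hfix, Finset.sum_apply, Pi.smul_apply, smul_eq_mul]
  rw [hmul, Matrix.mul_apply]

theorem tw_mul (h : H) (φ ψ : H → K) : tw h (φ * ψ) = tw h φ * tw h ψ := by
  funext g; simp [tw]

theorem tw_mem (h : H) (ψ : H → K) (hψ : ψ ∈ Submodule.span K (Set.range (tf H : K → H → K))) :
    tw h ψ ∈ Submodule.span K (Set.range (tf H : K → H → K)) := by
  rw [Finsupp.mem_span_range_iff_exists_finsupp] at hψ ⊢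
  obtain ⟨c, hc⟩ := hψ
  refine ⟨c.mapRange (fun x => h • x) (smul_zero h), ?_⟩
  have := tw_lc (fun x : K => x) h c
  rw [Finsupp.linearCombination_apply, Finsupp.linearCombination_apply, hc] at this
  exact this.symm

theorem T_mem (T : H → Matrix ι ι K) (hmul : ∀ g h : H, T (g * h) = T g * T h) (h1 : T 1 = 1)
    (hfix : ∀ (g h : H) i j, g • T h i j = T h i j) (Q : H → K) (hQ0 : Q ≠ 0)
    (hQ : Q ∈ Submodule.span K (Set.range (tf H : K → H → K)))
    (hQT : ∀ i j, (Q * fun g => T g i j) ∈ Submodule.span K (Set.range (tf H : K → H → K)))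
    (i j : ι) :
    (fun g => T g i j) ∈ Submodule.span K (Set.range (tf H : K → H → K)) := by
  classical
  set R := Submodule.span K (Set.range (tf H : K → H → K)) with hR
  let lc := Finsupp.linearCombination K (tf H : K → H → K)
  let P : (K →₀ K) → Prop := fun c => lc c ≠ 0 ∧ ∀ i j, (lc c * fun g => T g i j) ∈ R
  have hex : ∃ N, ∃ c, P c ∧ c.support.card = N := by
    rw [hR, Finsupp.mem_span_range_iff_exists_finsupp] at hQ
    obtain ⟨c, hc⟩ := hQ
    have hc' : lc c = Q := by rw [← hc]; exact Finsupp.linearCombination_apply ..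
    exact ⟨_, c, ⟨by rwa [hc'], by rwa [hc']⟩, rfl⟩
  obtain ⟨c, ⟨hc0, hcT⟩, hcard⟩ := Nat.find_spec hex
  have hmin := fun M => @Nat.find_min _ _ hex M
  rw [← hcard] at hmin
  have hcne : c ≠ 0 := by rintro rfl; simp [lc] at hc0
  obtain ⟨f0, hf0⟩ := Finsupp.ne_iff.1 hcne
  rw [Finsupp.zero_apply] at hf0
  let c' := (c f0)⁻¹ • c
  have hlc' : lc c' = (c f0)⁻¹ • lc c := map_smul ..
  have hq0 : lc c' ≠ 0 := by rw [hlc']; exact smul_ne_zero (inv_ne_zero hf0) hc0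
  have hqT : ∀ i j, (lc c' * fun g => T g i j) ∈ R := by
    intro i j; rw [hlc', smul_mul_assoc]; exact R.smul_mem _ (hcT i j)
  have hfixed : ∀ h, tw h (lc c') = lc c' := by
    intro h
    let c'' := c'.mapRange (fun x => h • x) (smul_zero h)
    have hc'' : lc c'' = tw h (lc c') := (tw_lc (fun x : K => x) h c').symm
    by_contra hne
    have hcard2 : (c'' - c').support.card < c.support.card := by
      apply Finset.card_lt_card
      rw [Finset.ssubset_iff_of_subset]
      · exact ⟨f0, by simpa using hf0, by simp [c'', c', hf0]⟩
      · intro x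
        simp only [Finsupp.mem_support_iff, c'', c']
        intro hx hx0
        exact hx (by simp [hx0])
    apply hmin _ hcard2
    refine ⟨_, ⟨?_, ?_⟩, rfl⟩
    · rw [map_sub, hc'']; exact sub_ne_zero.2 hne
    · intro i j
      rw [map_sub, hc'', sub_mul]
      refine R.sub_mem ?_ (hqT i j)
      have e : (tw h (lc c') * fun g => T g i j) =
          ∑ l, T h i l • tw h (lc c' * fun g => T g l j) := by
        funext g
        have e1 : T g = T h * T (h⁻¹ * g) := by rw [← hmul]; simp
        have e2 : T g i j = ∑ l, T h i l * T (h⁻¹ * g) l j := by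
          rw [e1, Matrix.mul_apply]
        simp only [Pi.mul_apply, Finset.sum_apply, Pi.smul_apply, smul_eq_mul, tw, smul_mul', hfix]
        rw [e2, Finset.mul_sum]
        refine Finset.sum_congr rfl fun l _ => by ring
      rw [e]
      exact R.sum_mem fun l _ => R.smul_mem _ (tw_mem h _ (hqT l j))
  have hq : lc c' = tf H (lc c' 1) := by
    funext g
    conv_lhs => rw [← hfixed g]
    simp [tw, tf]
  have hq1 : lc c' 1 ≠ 0 := by
    intro h0
    apply hq0
    rw [hq, h0]; funext g; simp [tf]
  have := span_mul_tf (H := H) (lc c' 1)⁻¹ _ (hqT i j)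
  have e : (tf H (lc c' 1)⁻¹ * (lc c' * fun g => T g i j)) = fun g => T g i j := by
    funext g
    have e1 : lc c' g = g • (lc c' 1) := congrFun hq g
    have e2 : g • (lc c' 1) ≠ 0 := (smul_ne_zero_iff_ne g).2 hq1
    simp only [Pi.mul_apply, tf, e1, smul_inv₀']
    field_simp
  rwa [e] at this

theorem hilb90 (T : H → Matrix ι ι K) (hmul : ∀ g h : H, T (g * h) = T g * T h) (h1 : T 1 = 1)
    (hfix : ∀ (g h : H) i j, g • T h i j = T h i j)
    (hT : ∀ i j, (fun g => T g i j) ∈ Submodule.span K (Set.range (tf H : K → H → K))) :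
    ∃ (I : Type) (_ : Fintype I) (C : I → Matrix ι ι K) (f : I → K),
      (∀ (h : H) b, (C b).map (fun x => h • x) = T h⁻¹ * C b) ∧ ∑ b, f b • C b = 1 := by
  classical
  obtain ⟨b, -, hspan, hb⟩ :=
    exists_linearIndependent (FixedPoints.subfield H K) (Set.univ : Set K)
  have hli : LinearIndependent K (fun x : b => tf H (x : K)) := tf_linInd hb
  have hle : Submodule.span K (Set.range (tf H : K → H → K)) ≤
      Submodule.span K (Set.range (fun x : b => tf H (x : K))) := by
    rw [Submodule.span_le]
    rintro _ ⟨x, rfl⟩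
    have := tf_span b x (by rw [hspan]; exact Submodule.subset_span trivial)
    rwa [Set.image_eq_range] at this
  have hT' : ∀ i j, ∃ c : b →₀ K,
      Finsupp.linearCombination K (fun x : b => tf H (x : K)) c = fun g => T g i j := by
    intro i j
    have := hle (hT i j)
    rw [Finsupp.mem_span_range_iff_exists_finsupp] at this
    exact this
  choose c hc using hT'
  let s : Finset b := Finset.univ.biUnion fun i => Finset.univ.biUnion fun j => (c i j).support
  refine ⟨s, inferInstance, fun x => Matrix.of fun i j => c i j x.1, fun x => x.1.1, ?_, ?_⟩
  · intro h x
    ext i j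
    have e1 := tw_lc (fun x : b => (x : K)) h (c i j)
    rw [hc, tw_T T hmul hfix] at e1
    simp_rw [← hc, ← map_smul, ← map_sum] at e1
    have e2 := DFunLike.congr_fun (hli e1) x.1
    simp only [Finsupp.coe_finsetSum, Finset.sum_apply, Finsupp.smul_apply,
      Finsupp.mapRange_apply, smul_eq_mul] at e2
    simp [Matrix.mul_apply, ← e2]
  · ext i j
    have e := congrFun (hc i j) 1
    simp only [h1] at e
    rw [← e, Finsupp.linearCombination_apply, Finsupp.sum_of_support_subset (s := s)]
    · simp only [Matrix.sum_apply, Finset.sum_apply, Pi.smul_apply, Matrix.smul_apply,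
        Matrix.of_apply, smul_eq_mul, tf, one_smul]
      rw [Finset.univ_eq_attach, Finset.sum_attach s (fun x : b => (x : K) * c i j x)]
      exact Finset.sum_congr rfl fun _ _ => mul_comm _ _
    · intro x hx
      simp only [s, Finset.mem_biUnion]
      exact ⟨i, Finset.mem_univ _, j, Finset.mem_univ _, hx⟩
    · simp
end AbsAlg



/-- point argument list for the action polynomials, over an algebra -/
def argL {n N : ℕ} {K : Type*} (g g' : Matrix (Fin n) (Fin n) K) (v : Fin N → K) :
    (Fin n × Fin n) ⊕ ((Fin n × Fin n) ⊕ Fin N) → K :=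
  Sum.elim (fun ab => g ab.1 ab.2) (Sum.elim (fun ab => g' ab.1 ab.2) v)

/-- coefficient matrix -/
abbrev cM {n : ℕ} (K : Type*) [CommRing K] [Algebra k K] (g : Matrix (Fin n) (Fin n) k) :
    Matrix (Fin n) (Fin n) K := g.map (algebraMap k K)

def coordAlg {n : ℕ} (V : PGLnVar k n) : Subalgebra k (V.carrier → k) :=
  (MvPolynomial.aeval (fun i (v : V.carrier) => v.1 i) :
    MvPolynomial (Fin V.N) k →ₐ[k] (V.carrier → k)).range

theorem aeval_coord {n : ℕ} (V : PGLnVar k n) (r : MvPolynomial (Fin V.N) k) (v : V.carrier) :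
    (MvPolynomial.aeval (fun i (v : V.carrier) => v.1 i) r : V.carrier → k) v =
      MvPolynomial.eval v.1 r := by
  induction r using MvPolynomial.induction_on with
  | C c => simp
  | add p q hp hq => simp [hp, hq]
  | mul_X p i hp => simp [hp]

theorem coordAlg_act {n : ℕ} (V : PGLnVar k n) (g : GL (Fin n) k) (f : V.carrier → k)
    (hf : f ∈ coordAlg k V) :
    (fun v : V.carrier => f ⟨V.act g v.1, V.act_mem g v.1 v.2⟩) ∈ coordAlg k V := by
  obtain ⟨r, rfl⟩ := hf
  refine ⟨MvPolynomial.aeval (fun j => MvPolynomial.aeval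
    (argL (cM k (MvPolynomial (Fin V.N) k) g.1) (cM k _ (g⁻¹ : GL (Fin n) k).1) MvPolynomial.X)
      (V.actP j)) r, ?_⟩
  funext v
  simp only [RingHom.coe_coe, AlgHom.toRingHom_eq_coe]
  rw [aeval_coord, aeval_coord]
  simp only [← MvPolynomial.aeval_eq_eval]
  rw [← AlgHom.comp_apply, MvPolynomial.comp_aeval]
  congr 2
  funext j
  rw [← AlgHom.comp_apply, MvPolynomial.comp_aeval, V.act_eval, ← MvPolynomial.aeval_eq_eval]
  congr 2
  funext l
  rcases l with l | l | l <;> simp [argL]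

instance coordAlgAct {n : ℕ} (V : PGLnVar k n) : MulSemiringAction (GL (Fin n) k) (coordAlg k V) where
  smul g f := ⟨_, coordAlg_act k V g⁻¹ f.1 f.2⟩
  one_smul f := by
    apply Subtype.ext; funext v
    change f.1 ⟨V.act 1⁻¹ v.1, _⟩ = f.1 v
    have : (⟨V.act 1⁻¹ v.1, V.act_mem _ _ v.2⟩ : V.carrier) = v :=
      Subtype.ext (by simp [V.act_one _ v.2])
    rw [this]
  mul_smul g h f := by
    apply Subtype.ext; funext v
    change f.1 ⟨V.act (g * h)⁻¹ v.1, _⟩ = f.1 ⟨V.act h⁻¹ (V.act g⁻¹ v.1), _⟩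
    have : (⟨V.act (g * h)⁻¹ v.1, V.act_mem _ _ v.2⟩ : V.carrier) =
        ⟨V.act h⁻¹ (V.act g⁻¹ v.1), V.act_mem _ _ (V.act_mem _ _ v.2)⟩ :=
      Subtype.ext (by simp [V.act_mul _ _ _ v.2])
    rw [this]
  smul_zero g := rfl
  smul_add g a b := rfl
  smul_one g := rfl
  smul_mul g a b := rfl

theorem coordAlg_domain {n : ℕ} (V : PGLnVar k n) (hV : V.IsIrr) : IsDomain (coordAlg k V) := by
  have : Nontrivial (coordAlg k V) := by
    obtain ⟨v, hv⟩ := hV.1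
    refine ⟨0, 1, fun h => ?_⟩
    have := congrFun (congrArg Subtype.val h) ⟨v, hv⟩
    simp at this
  have : NoZeroDivisors (coordAlg k V) := by
    constructor
    rintro ⟨_, p, rfl⟩ ⟨_, q, rfl⟩ h
    have h' : ∀ v : V.carrier, MvPolynomial.eval v.1 p * MvPolynomial.eval v.1 q = 0 := by
      intro v
      have := congrFun (congrArg Subtype.val h) v
      rw [← aeval_coord, ← aeval_coord]
      exact this
    have := hV.2 {v | ∀ r ∈ ({p} : Set (MvPolynomial (Fin V.N) k)), MvPolynomial.eval v r = 0}
      {v | ∀ r ∈ ({q} : Set (MvPolynomial (Fin V.N) k)), MvPolynomial.eval v r = 0}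
      ⟨_, rfl⟩ ⟨_, rfl⟩ (fun v hv => by simpa using h' ⟨v, hv⟩)
    refine this.imp (fun h => ?_) (fun h => ?_)
    all_goals
      apply Subtype.ext; funext v
      refine (aeval_coord k V _ v).trans ?_
      simpa using h v.2
  exact IsDomain.mk

theorem exists_fracField (G A : Type) [Group G] [CommRing A] [IsDomain A] [Algebra k A]
    [MulSemiringAction G A] :
    ∃ (K : Type) (_ : Field K) (_ : Algebra k K) (_ : MulSemiringAction G K)
      (i : A →ₐ[k] K), Function.Injective i ∧ (∀ (g : G) a, g • i a = i (g • a)) ∧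
      (∀ y : K, ∃ a b, i b ≠ 0 ∧ i b * y = i a) := by
  let _ : MulSemiringAction G (FractionRing A) :=
    IsFractionRing.mulSemiringAction G A (FractionRing A)
  refine ⟨FractionRing A, inferInstance, inferInstance, inferInstance,
    IsScalarTower.toAlgHom k A (FractionRing A), IsFractionRing.injective A _, ?_, ?_⟩
  · intro g a
    have : SMulDistribClass G A (FractionRing A) := IsFractionRing.smulDistribClass ..
    exact (algebraMap.coe_smul' g a (FractionRing A)).symm
  · intro y
    obtain ⟨a, b, hb, rfl⟩ := IsFractionRing.div_surjective (A := A) y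
    have : algebraMap A (FractionRing A) b ≠ 0 :=
      (map_ne_zero_iff _ (IsFractionRing.injective A _)).2 (nonZeroDivisors.ne_zero hb)
    exact ⟨a, b, this, mul_div_cancel₀ _ this⟩

theorem exists_funField {n : ℕ} (V : PGLnVar k n) (hV : V.IsIrr) :
    ∃ (K : Type) (_ : Field K) (_ : Algebra k K) (_ : MulSemiringAction (GL (Fin n) k) K)
      (ξ : Fin V.N → K),
      (∀ (g : GL (Fin n) k) (c : k), g • algebraMap k K c = algebraMap k K c) ∧
      (∀ r : MvPolynomial (Fin V.N) k, MvPolynomial.aeval ξ r = 0 ↔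
        ∀ v ∈ V.carrier, MvPolynomial.eval v r = 0) ∧
      (∀ y : K, ∃ s t : MvPolynomial (Fin V.N) k, MvPolynomial.aeval ξ t ≠ 0 ∧
        MvPolynomial.aeval ξ t * y = MvPolynomial.aeval ξ s) ∧
      (∀ (g : GL (Fin n) k) j, g⁻¹ • ξ j =
        MvPolynomial.aeval (argL (cM k K g.1) (cM k K (g⁻¹ : GL (Fin n) k).1) ξ) (V.actP j)) := by
  have := coordAlg_domain k V hV
  obtain ⟨K, _, _, _, i, hinj, hsm, hdiv⟩ := exists_fracField k (GL (Fin n) k) (coordAlg k V)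
  let π : MvPolynomial (Fin V.N) k →ₐ[k] coordAlg k V := AlgHom.rangeRestrict _
  have hπs : Function.Surjective π := AlgHom.rangeRestrict_surjective _
  have hπ : ∀ r (v : V.carrier), (π r).1 v = MvPolynomial.eval v.1 r :=
    fun r v => aeval_coord k V r v
  let ξ : Fin V.N → K := fun j => i (π (MvPolynomial.X j))
  have hξ : ∀ r, MvPolynomial.aeval ξ r = i (π r) := by
    intro r
    have : MvPolynomial.aeval ξ = i.comp π := by
      apply MvPolynomial.algHom_ext
      intro i; simp [ξ]
    rw [this]; rfl
  refine ⟨K, inferInstance, inferInstance, inferInstance, ξ, ?_, ?_, ?_, ?_⟩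
  · intro g c
    rw [← i.commutes, hsm]; rfl
  · intro r
    rw [hξ, map_eq_zero_iff _ hinj]
    constructor
    · intro h v hv
      rw [← hπ r ⟨v, hv⟩, h]; rfl
    · intro h
      apply Subtype.ext; funext v
      rw [hπ, h v.1 v.2]; rfl
  · intro y
    obtain ⟨a, b, hb, hab⟩ := hdiv y
    obtain ⟨s, rfl⟩ := hπs a
    obtain ⟨t, rfl⟩ := hπs b
    exact ⟨s, t, by rwa [hξ], by rwa [hξ, hξ]⟩
  · intro g j
    have e : MvPolynomial.aeval (argL (cM k K g.1) (cM k K (g⁻¹ : GL (Fin n) k).1) ξ) (V.actP j)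
      = i (MvPolynomial.aeval (argL (cM k (coordAlg k V) g.1)
        (cM k (coordAlg k V) (g⁻¹ : GL (Fin n) k).1)
        (fun i => π (MvPolynomial.X i))) (V.actP j)) := by
      rw [← AlgHom.comp_apply, MvPolynomial.comp_aeval]
      congr 2
      funext l
      rcases l with l | l | l <;> simp [argL, ξ]
    rw [e, hsm]
    congr 1
    apply Subtype.ext; funext v
    change (π (MvPolynomial.X j)).1 ⟨V.act g⁻¹⁻¹ v.1, _⟩ = _
    rw [hπ, MvPolynomial.eval_X]
    change V.act g⁻¹⁻¹ v.1 j = _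
    rw [inv_inv, V.act_eval]
    let ev : coordAlg k V →ₐ[k] k := (Pi.evalAlgHom k _ v).comp (coordAlg k V).val
    change _ = ev _
    rw [← MvPolynomial.coe_aeval_eq_eval, ← AlgHom.comp_apply, MvPolynomial.comp_aeval]
    simp only [RingHom.coe_coe]
    congr 2
    funext l
    rcases l with l | l | l
    · simp [argL, ev]
    · simp [argL, ev]
    · simp only [argL, Sum.elim_inr, ev]
      exact ((hπ _ v).trans (MvPolynomial.eval_X _)).symm


open scoped TensorProduct

theorem exists_two_homs {L : Type} [Field L] [Algebra k L] (L0 : IntermediateField k L) (s : L)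
    (hs : s ∉ L0) :
    ∃ (Ω : Type) (_ : CommRing Ω) (_ : Nontrivial Ω) (_ : Algebra k Ω) (σ τ : L →ₐ[k] Ω),
      (∀ x ∈ L0, σ x = τ x) ∧ IsUnit (σ s - τ s) := by
  have hs' : s ∉ (algebraMap L0 L).range := by
    rintro ⟨x, rfl⟩; exact hs x.2
  have : CharZero L0 := charZero_of_injective_algebraMap (algebraMap k L0).injective
  have hδ := aux_not_nilpotent s hs'
  set δ := (s ⊗ₜ[L0] (1 : L) - (1 : L) ⊗ₜ[L0] s) with hδdef
  let Ω := Localization.Away δ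
  have hnt : Nontrivial Ω := by
    rw [← not_subsingleton_iff_nontrivial]
    intro hsub
    rw [IsLocalization.subsingleton_iff (M := Submonoid.powers δ)] at hsub
    obtain ⟨n, hn⟩ := hsub
    exact hδ ⟨n, hn⟩
  let ι : (L ⊗[L0] L) →ₐ[k] Ω := IsScalarTower.toAlgHom k (L ⊗[L0] L) Ω
  refine ⟨Ω, inferInstance, hnt, inferInstance,
    ι.comp ((Algebra.TensorProduct.includeLeft : L →ₐ[L0] L ⊗[L0] L).restrictScalars k),
    ι.comp ((Algebra.TensorProduct.includeRight : L →ₐ[L0] L ⊗[L0] L).restrictScalars k), ?_, ?_⟩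
  · intro x hx
    have : (x ⊗ₜ[L0] (1 : L)) = (1 : L) ⊗ₜ[L0] x :=
      Algebra.TensorProduct.tmul_one_eq_one_tmul (⟨x, hx⟩ : L0)
    simp [this]
  · have : IsUnit (algebraMap (L ⊗[L0] L) Ω δ) := IsLocalization.Away.algebraMap_isUnit δ
    simpa [ι, hδdef] using this

theorem key_field {n : ℕ} (V : PGLnVar k n) (p : MvPolynomial (Fin V.N) k)
    (hp : ∀ v ∈ V.carrier, MvPolynomial.eval v p ≠ 0 →
      ∀ g : GL (Fin n) k, V.act g v = v → ∃ c : kˣ, g = scalarGL k c)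
    {L : Type} [Field L] [Algebra k L] (g g' : Matrix (Fin n) (Fin n) L) (hgg : g * g' = 1)
    (η : Fin V.N → L)
    (hη : ∀ r : MvPolynomial (Fin V.N) k, (∀ v ∈ V.carrier, MvPolynomial.eval v r = 0) →
      MvPolynomial.aeval η r = 0) (hpη : MvPolynomial.aeval η p ≠ 0) (i j a b : Fin n) :
    g i a * g' b j ∈ IntermediateField.adjoin k (Set.range (Sum.elim η
      (fun l => MvPolynomial.aeval (argL g g' η) (V.actP l)))) := by
  by_contra hs
  obtain ⟨Ω, _, _, _, σ, τ, hστ, hu⟩ := exists_two_homs k _ _ hs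
  obtain ⟨δ', hδ'⟩ := hu.exists_right_inv
  have hη' : ∀ l, σ (η l) = τ (η l) := fun l =>
    hστ _ (IntermediateField.subset_adjoin _ _ ⟨Sum.inl l, rfl⟩)
  have hw : ∀ l, σ (MvPolynomial.aeval (argL g g' η) (V.actP l)) =
      τ (MvPolynomial.aeval (argL g g' η) (V.actP l)) := fun l =>
    hστ _ (IntermediateField.subset_adjoin _ _ ⟨Sum.inr l, rfl⟩)
  let M := Fin n × Fin n
  let ω : (M ⊕ M) ⊕ (M ⊕ M) ⊕ Fin V.N ⊕ Bool → Ω :=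
    Sum.elim (Sum.elim (fun x => σ (g x.1 x.2)) (fun x => σ (g' x.1 x.2)))
      (Sum.elim (Sum.elim (fun x => τ (g x.1 x.2)) (fun x => τ (g' x.1 x.2)))
        (Sum.elim (fun l => σ (η l)) (fun t => if t then δ' else σ (MvPolynomial.aeval η p)⁻¹)))
  obtain ⟨c, hc⟩ := aux_nullst (k := k) ω
  have hc2 : ∀ P Q : MvPolynomial _ k, MvPolynomial.aeval ω P = MvPolynomial.aeval ω Q →
      MvPolynomial.eval c P = MvPolynomial.eval c Q := by
    intro P Q h
    have := hc (P - Q) (by rw [map_sub, h, sub_self])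
    rwa [map_sub, sub_eq_zero] at this
  let g1 : Matrix (Fin n) (Fin n) k := Matrix.of fun x y => c (Sum.inl (Sum.inl (x, y)))
  let g1' : Matrix (Fin n) (Fin n) k := Matrix.of fun x y => c (Sum.inl (Sum.inr (x, y)))
  let g2 : Matrix (Fin n) (Fin n) k := Matrix.of fun x y => c (Sum.inr (Sum.inl (Sum.inl (x, y))))
  let g2' : Matrix (Fin n) (Fin n) k := Matrix.of fun x y => c (Sum.inr (Sum.inl (Sum.inr (x, y))))
  let v : Fin V.N → k := fun l => c (Sum.inr (Sum.inr (Sum.inl l)))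
  have hgg' : ∀ x y, ∑ l, g x l * g' l y = (1 : Matrix (Fin n) (Fin n) L) x y := by
    intro x y; rw [← hgg, Matrix.mul_apply]
  have h1 : g1 * g1' = 1 := by
    ext x y
    have := hc2 (∑ l, MvPolynomial.X (Sum.inl (Sum.inl (x, l))) *
      MvPolynomial.X (Sum.inl (Sum.inr (l, y)))) (MvPolynomial.C ((1 : Matrix (Fin n) (Fin n) k) x y)) (by
        simp only [map_sum, map_mul, MvPolynomial.aeval_X, ω, Sum.elim_inl, Sum.elim_inr]
        simp only [← map_mul, ← map_sum, hgg']
        by_cases hxy : x = y <;> simp [Matrix.one_apply, hxy])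
    simpa [Matrix.mul_apply, g1, g1'] using this
  have h2 : g2 * g2' = 1 := by
    ext x y
    have := hc2 (∑ l, MvPolynomial.X (Sum.inr (Sum.inl (Sum.inl (x, l)))) *
      MvPolynomial.X (Sum.inr (Sum.inl (Sum.inr (l, y)))))
      (MvPolynomial.C ((1 : Matrix (Fin n) (Fin n) k) x y)) (by
        simp only [map_sum, map_mul, MvPolynomial.aeval_X, ω, Sum.elim_inl, Sum.elim_inr]
        simp only [← map_mul, ← map_sum, hgg']
        by_cases hxy : x = y <;> simp [Matrix.one_apply, hxy])
    simpa [Matrix.mul_apply, g2, g2'] using this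
  have hren : ∀ r : MvPolynomial (Fin V.N) k, MvPolynomial.aeval ω (MvPolynomial.rename
      (fun l => Sum.inr (Sum.inr (Sum.inl l))) r) = σ (MvPolynomial.aeval η r) := by
    intro r
    rw [MvPolynomial.aeval_rename, ← AlgHom.comp_apply, MvPolynomial.comp_aeval]
    rfl
  have hrenc : ∀ r : MvPolynomial (Fin V.N) k, MvPolynomial.eval c (MvPolynomial.rename
      (fun l => Sum.inr (Sum.inr (Sum.inl l))) r) = MvPolynomial.eval v r := by
    intro r
    rw [MvPolynomial.eval_rename]; rfl
  have hv : v ∈ V.carrier := by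
    obtain ⟨S, hS⟩ := V.closed
    rw [hS]
    intro r hr
    rw [← hrenc]
    apply hc
    rw [hren, hη, map_zero]
    intro v hv
    rw [hS] at hv
    exact hv r hr
  have hpv : MvPolynomial.eval v p ≠ 0 := by
    have := hc2 (MvPolynomial.rename (fun l => Sum.inr (Sum.inr (Sum.inl l))) p *
      MvPolynomial.X (Sum.inr (Sum.inr (Sum.inr false)))) 1 (by
        rw [map_mul, hren, map_one, MvPolynomial.aeval_X]
        simp only [ω, Sum.elim_inr]
        rw [← map_one σ, if_neg (by simp), ← map_mul, mul_inv_cancel₀ hpη])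
    rw [map_mul, map_one, hrenc] at this
    exact left_ne_zero_of_mul_eq_one this
  let G1 : GL (Fin n) k := ⟨g1, g1', h1, mul_eq_one_comm.1 h1⟩
  let G2 : GL (Fin n) k := ⟨g2, g2', h2, mul_eq_one_comm.1 h2⟩
  have hact : V.act G1 v = V.act G2 v := by
    funext l
    have := hc2 (MvPolynomial.rename (Sum.elim (fun x => Sum.inl (Sum.inl x))
        (Sum.elim (fun x => Sum.inl (Sum.inr x)) (fun l => Sum.inr (Sum.inr (Sum.inl l))))) (V.actP l))
      (MvPolynomial.rename (Sum.elim (fun x => Sum.inr (Sum.inl (Sum.inl x)))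
        (Sum.elim (fun x => Sum.inr (Sum.inl (Sum.inr x)))
          (fun l => Sum.inr (Sum.inr (Sum.inl l))))) (V.actP l)) (by
        rw [MvPolynomial.aeval_rename, MvPolynomial.aeval_rename]
        convert hw l using 1
        · rw [← AlgHom.comp_apply, MvPolynomial.comp_aeval]
          congr 2
          funext z
          rcases z with z | z | z <;> simp [ω, argL]
        · rw [← AlgHom.comp_apply, MvPolynomial.comp_aeval]
          congr 2
          funext z
          rcases z with z | z | z <;> simp [ω, argL, hη'])
    rw [MvPolynomial.eval_rename, MvPolynomial.eval_rename] at this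
    rw [V.act_eval, V.act_eval]
    convert this using 3
    · funext z
      rcases z with z | z | z <;> rfl
    · funext z
      rcases z with z | z | z <;> rfl
  have hne : g1 i a * g1' b j ≠ g2 i a * g2' b j := by
    intro heq
    have := hc2 ((MvPolynomial.X (Sum.inl (Sum.inl (i, a))) * MvPolynomial.X (Sum.inl (Sum.inr (b, j)))
      - MvPolynomial.X (Sum.inr (Sum.inl (Sum.inl (i, a)))) *
        MvPolynomial.X (Sum.inr (Sum.inl (Sum.inr (b, j))))) *
      MvPolynomial.X (Sum.inr (Sum.inr (Sum.inr true)))) 1 (by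
        simpa [ω] using hδ')
    have h0 : g1 i a * g1' b j - g2 i a * g2' b j = 0 := by rw [heq, sub_self]
    simp only [g1, g2, g1', g2', Matrix.of_apply] at h0
    simp [h0] at this
  have hstab : V.act (G2⁻¹ * G1) v = v := by
    rw [V.act_mul _ _ _ hv, hact, ← V.act_mul _ _ _ hv, inv_mul_cancel, V.act_one _ hv]
  obtain ⟨e, he⟩ := hp v hv hpv _ hstab
  have hG : G1 = G2 * scalarGL k e := by rw [← he]; group
  have hG' : G1⁻¹ = scalarGL k e⁻¹ * G2⁻¹ := by
    rw [hG, mul_inv_rev]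
    congr 1
  apply hne
  have e1 : g1 i a = g2 i a * e := by
    change G1.1 i a = G2.1 i a * e
    rw [hG]
    simp [scalarGL, Matrix.algebraMap_eq_diagonal]
  have e2 : g1' b j = (e⁻¹ : kˣ) * g2' b j := by
    change (G1⁻¹).1 b j = (e⁻¹ : kˣ) * (G2⁻¹).1 b j
    rw [hG']
    simp [scalarGL, Matrix.algebraMap_eq_diagonal]
  rw [e1, e2]
  have := e.mul_inv
  calc _ = g2 i a * g2' b j * ((e : k) * (e⁻¹ : kˣ)) := by ring
    _ = _ := by rw [this, mul_one]



theorem common_den {S K : Type} [CommRing S] [Field K] (φ : S →+* K) {ι : Type} [Finite ι] (y : ι → K)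
    (h : ∀ i, ∃ s t, φ t ≠ 0 ∧ φ t * y i = φ s) :
    ∃ (t : S) (s : ι → S), φ t ≠ 0 ∧ ∀ i, φ t * y i = φ (s i) := by
  classical
  cases nonempty_fintype ι
  choose s t ht hs using h
  refine ⟨∏ i, t i, fun i => (∏ j ∈ Finset.univ.erase i, t j) * s i, ?_, ?_⟩
  · rw [map_prod]; exact Finset.prod_ne_zero_iff.2 fun i _ => ht i
  · intro i
    rw [← Finset.mul_prod_erase _ _ (Finset.mem_univ i), map_mul, map_mul, ← hs]
    ring

theorem aux_spec_val {k K K' S : Type} [Field k] [Field K] [Field K'] [CommRing S] [Algebra k S]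
    [Algebra k K] [Algebra k K'] (θ : S →ₐ[k] K) (a : S →ₐ[k] K') (hle : ∀ s, θ s = 0 → a s = 0)
    {σ : Type} (x : σ → K) (y : σ → K')
    (hxy : ∀ i, ∃ s t, a t ≠ 0 ∧ θ t * x i = θ s ∧ a t * y i = a s) (r : MvPolynomial σ k)
    (s t : S) (h0 : θ t * MvPolynomial.aeval x r = θ s) :
    a t * MvPolynomial.aeval y r = a s := by
  have := aux_spec θ a hle (Sum.elim x (fun b : Bool => θ (if b then s else t)))
    (Sum.elim y (fun b : Bool => a (if b then s else t)))
    (by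
      rintro (i | b)
      · exact hxy i
      · exact ⟨if b then s else t, 1, by simp, by simp, by simp⟩)
    (MvPolynomial.X (Sum.inr false) * MvPolynomial.rename Sum.inl r - MvPolynomial.X (Sum.inr true))
    (by
      rw [map_sub, map_mul, MvPolynomial.aeval_rename, Sum.elim_comp_inl]
      simp [h0])
  rw [map_sub, map_mul, MvPolynomial.aeval_rename, Sum.elim_comp_inl] at this
  simpa [sub_eq_zero] using this

theorem generic_rel {n : ℕ} (V : PGLnVar k n) (p : MvPolynomial (Fin V.N) k)
    (hp : ∀ v ∈ V.carrier, MvPolynomial.eval v p ≠ 0 →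
      ∀ g : GL (Fin n) k, V.act g v = v → ∃ c : kˣ, g = scalarGL k c)
    {K : Type} [Field K] [Algebra k K] (ξ : Fin V.N → K)
    (hξ : ∀ r : MvPolynomial (Fin V.N) k, (∀ v ∈ V.carrier, MvPolynomial.eval v r = 0) →
      MvPolynomial.aeval ξ r = 0) (hpξ : MvPolynomial.aeval ξ p ≠ 0) :
    ∃ (Q : MvPolynomial (Fin V.N ⊕ Fin V.N) k)
      (P : (Fin n × Fin n) × (Fin n × Fin n) → MvPolynomial (Fin V.N ⊕ Fin V.N) k),
      (∀ (g : GL (Fin n) k) (i j a b : Fin n),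
        MvPolynomial.aeval (Sum.elim ξ (fun l => MvPolynomial.aeval
          (argL (cM k K g.1) (cM k K (g⁻¹ : GL (Fin n) k).1) ξ) (V.actP l))) Q *
        algebraMap k K (g.1 i a * (g⁻¹ : GL (Fin n) k).1 b j) =
        MvPolynomial.aeval (Sum.elim ξ (fun l => MvPolynomial.aeval
          (argL (cM k K g.1) (cM k K (g⁻¹ : GL (Fin n) k).1) ξ) (V.actP l))) (P ((i, j), (a, b)))) ∧
      ∃ g : GL (Fin n) k, MvPolynomial.aeval (Sum.elim ξ (fun l => MvPolynomial.aeval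
          (argL (cM k K g.1) (cM k K (g⁻¹ : GL (Fin n) k).1) ξ) (V.actP l))) Q ≠ 0 := by
  classical
  let S := MvPolynomial (Fin n × Fin n) K
  let L := FractionRing S
  let θ : S →ₐ[k] L := IsScalarTower.toAlgHom k S L
  have hθ : Function.Injective θ := IsFractionRing.injective S L
  let X0 : Matrix (Fin n) (Fin n) S := Matrix.mvPolynomialX (Fin n) (Fin n) K
  have hX0 : X0.det ≠ 0 := Matrix.det_mvPolynomialX_ne_zero (Fin n) K
  let X : Matrix (Fin n) (Fin n) L := X0.map θ
  have hXdet : X.det = θ X0.det := by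
    exact (AlgHom.map_det θ X0).symm
  have hXne : X.det ≠ 0 := by
    rw [hXdet]; exact (map_ne_zero_iff θ hθ).2 hX0
  let η : Fin V.N → L := fun l => θ (MvPolynomial.C (ξ l))
  have hη0 : ∀ r : MvPolynomial (Fin V.N) k, MvPolynomial.aeval η r =
      θ (MvPolynomial.C (MvPolynomial.aeval ξ r)) := by
    intro r
    let θ' : K →ₐ[k] L := θ.comp (IsScalarTower.toAlgHom k K S)
    have : MvPolynomial.aeval η r = θ' (MvPolynomial.aeval ξ r) := by
      rw [← AlgHom.comp_apply, MvPolynomial.comp_aeval]; rfl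
    exact this
  have hXX : X * X⁻¹ = 1 := Matrix.mul_nonsing_inv _ (isUnit_iff_ne_zero.2 hXne)
  let w : Fin V.N ⊕ Fin V.N → L := Sum.elim η
      (fun l => MvPolynomial.aeval (argL X X⁻¹ η) (V.actP l))
  have hkey : ∀ i j a b, X i a * X⁻¹ b j ∈ IntermediateField.adjoin k (Set.range w) := by
    intro i j a b
    refine key_field k V p hp X X⁻¹ hXX η (fun r hr => by rw [hη0, hξ r hr]; simp) ?_ i j a b
    rw [hη0]
    refine (map_ne_zero_iff θ hθ).2 ?_
    exact (map_ne_zero_iff _ (MvPolynomial.C_injective _ _)).2 hpξ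
  obtain ⟨Q, P, hQ, hP⟩ := common_den (MvPolynomial.aeval w : _ →ₐ[k] L).toRingHom
    (fun z : (Fin n × Fin n) × (Fin n × Fin n) => X z.1.1 z.2.1 * X⁻¹ z.2.2 z.1.2) (by
      intro z
      obtain ⟨r, s, hrs⟩ := (IntermediateField.mem_adjoin_range_iff (F := k) w _).1
        (hkey z.1.1 z.1.2 z.2.1 z.2.2)
      by_cases hs : MvPolynomial.aeval w s = 0
      · exact ⟨0, 1, by simp, by simp [hrs, hs]⟩
      · exact ⟨r, s, hs, by rw [hrs]; exact mul_div_cancel₀ _ hs⟩)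
  -- substitution of the action polynomials
  let sub : Fin V.N ⊕ Fin V.N → MvPolynomial ((Fin n × Fin n) ⊕ ((Fin n × Fin n) ⊕ Fin V.N)) k :=
    Sum.elim (fun l => MvPolynomial.X (Sum.inr (Sum.inr l))) V.actP
  have hsub : ∀ {E : Type} [Field E] [Algebra k E] (A B : Matrix (Fin n) (Fin n) E)
      (e : Fin V.N → E) (r : MvPolynomial (Fin V.N ⊕ Fin V.N) k),
      MvPolynomial.aeval (argL A B e) (MvPolynomial.aeval sub r) =
      MvPolynomial.aeval (Sum.elim e (fun l => MvPolynomial.aeval (argL A B e) (V.actP l))) r := by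
    intro E _ _ A B e r
    rw [← AlgHom.comp_apply, MvPolynomial.comp_aeval]
    congr 2
    funext l
    rcases l with l | l <;> simp [sub, argL]
  let ev : GL (Fin n) k → (S →ₐ[k] K) := fun g =>
    (MvPolynomial.aeval (fun z : Fin n × Fin n => algebraMap k K (g.1 z.1 z.2)) :
      S →ₐ[K] K).restrictScalars k
  have hev1 : ∀ (g : GL (Fin n) k) z, ev g (MvPolynomial.X z) = algebraMap k K (g.1 z.1 z.2) :=
    fun g z => MvPolynomial.aeval_X _ _
  have hev2 : ∀ (g : GL (Fin n) k) c, ev g (MvPolynomial.C c) = c :=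
    fun g c => MvPolynomial.aeval_C _ _
  have hevX : ∀ g : GL (Fin n) k, X0.map (ev g) = cM k K g.1 := by
    intro g; ext i j; exact hev1 g (i, j)
  have hevdet : ∀ g : GL (Fin n) k, ev g X0.det = (cM k K g.1).det := by
    intro g; rw [← hevX]; exact AlgHom.map_det (ev g) X0
  have hgdet : ∀ g : GL (Fin n) k, (cM k K g.1).det ≠ 0 := by
    intro g
    have : (cM k K g.1).det = algebraMap k K g.1.det := (RingHom.map_det (algebraMap k K) g.1).symm
    rw [this]
    refine (map_ne_zero _).2 ?_
    exact (Matrix.isUnits_det_units g).ne_zero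
  have hginv : ∀ g : GL (Fin n) k, cM k K (g⁻¹ : GL (Fin n) k).1 = (cM k K g.1)⁻¹ := by
    intro g
    symm
    apply Matrix.inv_eq_right_inv
    have : cM k K g.1 * cM k K (g⁻¹ : GL (Fin n) k).1 = cM k K (g.1 * (g⁻¹ : GL (Fin n) k).1) :=
      (Matrix.map_mul).symm
    rw [this]
    have h1 : g.1 * (g⁻¹ : GL (Fin n) k).1 = 1 := g.mul_inv
    rw [h1]
    exact Matrix.map_one _ (map_zero _) (map_one _)
  have hxy : ∀ (g : GL (Fin n) k) i, ∃ s t, ev g t ≠ 0 ∧ θ t * argL X X⁻¹ η i = θ s ∧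
      ev g t * argL (cM k K g.1) (cM k K (g⁻¹ : GL (Fin n) k).1) ξ i = ev g s := by
    intro g i
    rcases i with z | z | l
    · refine ⟨X0 z.1 z.2, 1, by simp, by simp [argL, X], ?_⟩
      rw [map_one, one_mul]; exact (hev1 g z).symm
    · refine ⟨X0.adjugate z.1 z.2, X0.det, by rw [hevdet]; exact hgdet g, ?_, ?_⟩
      · simp only [argL, Sum.elim_inr, Sum.elim_inl]
        rw [← hXdet, Matrix.inv_def, Matrix.smul_apply, Ring.inverse_eq_inv', smul_eq_mul,
          mul_inv_cancel_left₀ hXne]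
        exact (congrFun (congrFun (AlgHom.map_adjugate θ X0) z.1) z.2).symm
      · simp only [argL, Sum.elim_inr, Sum.elim_inl]
        rw [hevdet, hginv, Matrix.inv_def, Matrix.smul_apply, Ring.inverse_eq_inv', smul_eq_mul,
          mul_inv_cancel_left₀ (hgdet g), ← hevX]
        exact (congrFun (congrFun (AlgHom.map_adjugate (ev g) X0) z.1) z.2).symm
    · refine ⟨MvPolynomial.C (ξ l), 1, by simp, by simp [argL, η], ?_⟩
      rw [map_one, one_mul]; exact (hev2 g _).symm
  have hle : ∀ (g : GL (Fin n) k) s, θ s = 0 → ev g s = 0 := by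
    intro g s hs
    rw [(map_eq_zero_iff θ hθ).1 hs, map_zero]
  refine ⟨Q, P, ?_, ?_⟩
  · intro g i j a b
    have := aux_spec θ (ev g) (hle g) (argL X X⁻¹ η)
      (argL (cM k K g.1) (cM k K (g⁻¹ : GL (Fin n) k).1) ξ) (hxy g)
      (MvPolynomial.aeval sub Q * (MvPolynomial.X (Sum.inl (i, a)) *
        MvPolynomial.X (Sum.inr (Sum.inl (b, j)))) - MvPolynomial.aeval sub (P ((i, j), (a, b)))) (by
        rw [map_sub, map_mul, hsub, hsub, sub_eq_zero]
        have := hP ((i, j), (a, b))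
        simp only [map_mul, MvPolynomial.aeval_X]
        exact this)
    rw [map_sub, map_mul, hsub, hsub, sub_eq_zero] at this
    rw [← this]
    simp [argL]
  · obtain ⟨s, t, ht, hst⟩ : ∃ s t : S, t ≠ 0 ∧ θ t * MvPolynomial.aeval w Q = θ s := by
      obtain ⟨a, b, hb, hab⟩ := IsFractionRing.div_surjective (A := S) (MvPolynomial.aeval w Q)
      have hb' := nonZeroDivisors.ne_zero hb
      refine ⟨a, b, hb', ?_⟩
      rw [← hab]
      exact mul_div_cancel₀ _ ((map_ne_zero_iff θ hθ).2 hb')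
    have hs : s ≠ 0 := by
      rintro rfl
      rw [map_zero] at hst
      rcases mul_eq_zero.1 hst with h | h
      · exact ht ((map_eq_zero_iff θ hθ).1 h)
      · exact hQ h
    obtain ⟨c, hc⟩ : ∃ c : Fin n × Fin n → k,
        MvPolynomial.eval (fun z => algebraMap k K (c z)) (s * X0.det) ≠ 0 := by
      by_contra hcon
      push Not at hcon
      refine mul_ne_zero hs hX0 (MvPolynomial.funext_set
        (fun _ => Set.range (algebraMap k K)) (fun _ =>
          Set.infinite_range_of_injective (algebraMap k K).injective) ?_)
      intro x hx
      choose c hc using fun z => hx z (Set.mem_univ _)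
      have := hcon c
      rw [map_zero, ← this]
      congr 1
      simp [hc]
    let G : Matrix (Fin n) (Fin n) k := Matrix.of fun i j => c (i, j)
    have hGev : ∀ r : S, MvPolynomial.eval (fun z => algebraMap k K (c z)) r =
       MvPolynomial.aeval (fun z => algebraMap k K (c z)) r := fun r => by
        rw [MvPolynomial.aeval_eq_eval]; 
    have hGdet : G.det ≠ 0 := by
      intro h0
      apply hc
      rw [map_mul]
      convert mul_zero _
      have e1 : MvPolynomial.eval (fun z => algebraMap k K (c z)) X0.det =
          (X0.map (MvPolynomial.eval (fun z => algebraMap k K (c z)))).det :=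
        RingHom.map_det _ _
      have e2 : X0.map (MvPolynomial.eval (fun z => algebraMap k K (c z))) = cM k K G := by
        ext i j; simp [X0, G]
      rw [e1, e2]
      have : (cM k K G).det = algebraMap k K G.det := (RingHom.map_det (algebraMap k K) G).symm
      rw [this, h0, map_zero]
    let g : GL (Fin n) k := Matrix.GeneralLinearGroup.mkOfDetNeZero G hGdet
    refine ⟨g, ?_⟩
    have := aux_spec_val θ (ev g) (hle g) (argL X X⁻¹ η)
      (argL (cM k K g.1) (cM k K (g⁻¹ : GL (Fin n) k).1) ξ) (hxy g)
      (MvPolynomial.aeval sub Q) s t (by rw [hsub]; exact hst)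
    rw [hsub] at this
    intro h0
    rw [h0, mul_zero] at this
    apply hc
    rw [map_mul]
    convert zero_mul _
    rw [hGev]
    exact this.symm



theorem span_tf_eq {H K : Type} [Group H] [Field K] [MulSemiringAction H K] (W : Submonoid K) :
    Subalgebra.toSubmodule (Algebra.adjoin K (tf H '' (W : Set K))) =
      Submodule.span K (tf H '' (W : Set K)) := by
  let t : K →* (H → K) :=
    { toFun := tf H
      map_one' := by funext g; simp [tf]
      map_mul' := tf_mul }
  rw [Algebra.adjoin_eq_span]
  congr 1
  have : (tf H '' (W : Set K)) = ((W.map t : Submonoid (H → K)) : Set (H → K)) := rfl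
  rw [this, Submonoid.closure_eq]

theorem aeval_mem_fun {H K σ : Type} [Field K] [Algebra k K] (A : Subalgebra K (H → K))
    (y : H → σ → K) (hy : ∀ l, (fun g => y g l) ∈ A) (r : MvPolynomial σ k) :
    (fun g => MvPolynomial.aeval (y g) r) ∈ A := by
  induction r using MvPolynomial.induction_on with
  | C c =>
    simp only [MvPolynomial.aeval_C]
    exact A.algebraMap_mem (algebraMap k K c)
  | add p q hp hq =>
    simp only [map_add]
    exact A.add_mem hp hq
  | mul_X p i hp =>
    simp only [map_mul, MvPolynomial.aeval_X]
    exact A.mul_mem hp (hy i)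

theorem pair_mem {H K M : Type} [Field K] [Fintype M] [DecidableEq M] (A : Subalgebra K (H → K))
    (y y' : H → M → K) (hy : ∀ z w, (fun h => y h z * y' h w) ∈ A) (α β : M → ℕ)
    (hαβ : ∑ z, α z = ∑ z, β z) :
    (fun h => (∏ z, y h z ^ α z) * ∏ z, y' h z ^ β z) ∈ A := by
  have key : ∀ s t : Multiset M, s.card = t.card →
      (fun h => (s.map (y h)).prod * (t.map (y' h)).prod) ∈ A := by
    intro s
    induction s using Multiset.induction_on with
    | empty =>
      intro t ht
      have : t = 0 := Multiset.card_eq_zero.1 (by simpa using ht.symm)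
      subst this
      simp only [Multiset.map_zero, Multiset.prod_zero, mul_one]
      exact A.one_mem
    | cons a s ih =>
      intro t ht
      rw [Multiset.card_cons] at ht
      obtain ⟨b, hb⟩ := Multiset.card_pos_iff_exists_mem.1 (show 0 < t.card by omega)
      obtain ⟨t, rfl⟩ := Multiset.exists_cons_of_mem hb
      rw [Multiset.card_cons] at ht
      have ht' : t.card = s.card := by omega
      have := A.mul_mem (hy a b) (ih t ht'.symm)
      convert this using 1
      funext h
      simp only [Multiset.map_cons, Multiset.prod_cons, Pi.mul_apply]
      ring
  have := key (∑ z, Multiset.replicate (α z) z) (∑ z, Multiset.replicate (β z) z) (by simpa using hαβ)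
  convert this using 1
  funext h
  have e : ∀ (c : M → K) (γ : M → ℕ), ((∑ z, Multiset.replicate (γ z) z).map c).prod =
      ∏ z, c z ^ γ z := by
    intro c γ
    have : ((∑ z, Multiset.replicate (γ z) z).map c) = ∑ z, (Multiset.replicate (γ z) z).map c :=
      map_sum (Multiset.mapAddMonoidHom c) _ _
    rw [this, Multiset.prod_sum]
    simp
  rw [e, e]

theorem weight_zero {H K M N : Type} [Field K] [Algebra k K] [Fintype M] [DecidableEq M] [Fintype N]
    (A : Subalgebra K (H → K)) (y y' : H → M → K) (hy : ∀ z w, (fun h => y h z * y' h w) ∈ A)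
    (ξ : N → K) (r : MvPolynomial (M ⊕ (M ⊕ N)) k)
    (hinv : ∀ (h : H) (c : kˣ), MvPolynomial.aeval
      (Sum.elim (fun z => algebraMap k K c * y h z)
        (Sum.elim (fun z => algebraMap k K (c⁻¹ : kˣ) * y' h z) ξ)) r =
      MvPolynomial.aeval (Sum.elim (y h) (Sum.elim (y' h) ξ)) r) :
    (fun h => MvPolynomial.aeval (Sum.elim (y h) (Sum.elim (y' h) ξ)) r) ∈ A := by
  classical
  let α : (M ⊕ (M ⊕ N) →₀ ℕ) → ℕ := fun m => ∑ z, m (Sum.inl z)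
  let β : (M ⊕ (M ⊕ N) →₀ ℕ) → ℕ := fun m => ∑ z, m (Sum.inr (Sum.inl z))
  let mon : (M ⊕ (M ⊕ N) →₀ ℕ) → H → K := fun m h =>
    algebraMap k K (r.coeff m) * (((∏ z, y h z ^ m (Sum.inl z)) *
      ∏ z, y' h z ^ m (Sum.inr (Sum.inl z))) * ∏ l, ξ l ^ m (Sum.inr (Sum.inr l)))
  have hF : ∀ h, MvPolynomial.aeval (Sum.elim (y h) (Sum.elim (y' h) ξ)) r =
      ∑ m ∈ r.support, mon m h := by
    intro h
    rw [MvPolynomial.aeval_def, MvPolynomial.eval₂_eq']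
    refine Finset.sum_congr rfl fun m _ => ?_
    simp only [Fintype.prod_sum_type, Sum.elim_inl, Sum.elim_inr, mon]
    ring
  have hFc : ∀ h (c : kˣ), MvPolynomial.aeval
      (Sum.elim (fun z => algebraMap k K c * y h z)
        (Sum.elim (fun z => algebraMap k K (c⁻¹ : kˣ) * y' h z) ξ)) r =
      ∑ m ∈ r.support, algebraMap k K c ^ α m * algebraMap k K (c⁻¹ : kˣ) ^ β m * mon m h := by
    intro h c
    rw [MvPolynomial.aeval_def, MvPolynomial.eval₂_eq']
    refine Finset.sum_congr rfl fun m _ => ?_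
    simp only [Fintype.prod_sum_type, Sum.elim_inl, Sum.elim_inr, mon, mul_pow,
      Finset.prod_mul_distrib, Finset.prod_pow_eq_pow_sum, α, β]
    ring
  let D := r.support.sup β
  have hD : ∀ m ∈ r.support, β m ≤ D := fun m hm => Finset.le_sup hm
  have hzero : ∀ h, ∑ m ∈ r.support, mon m h = ∑ m ∈ r.support with α m = β m, mon m h := by
    intro h
    let pol : Polynomial K := ∑ m ∈ r.support, Polynomial.C (mon m h) * Polynomial.X ^ (D + α m - β m)
      - Polynomial.C (∑ m ∈ r.support, mon m h) * Polynomial.X ^ D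
    have hpol : pol = 0 := by
      have hinj : Function.Injective (fun c : k => algebraMap k K c) := (algebraMap k K).injective
      have hinf : (({0}ᶜ : Set k)).Infinite := (Set.finite_singleton (0 : k)).infinite_compl
      refine Polynomial.eq_zero_of_infinite_isRoot pol
        ((hinf.image hinj.injOn).mono ?_)
      rintro _ ⟨c, hc, rfl⟩
      have hc0 : c ≠ 0 := hc
      let cu : kˣ := Units.mk0 c hc0
      have h1 := hinv h cu
      rw [hFc, hF] at h1
      have hcK : algebraMap k K c ≠ 0 := (map_ne_zero _).2 hc0
      change Polynomial.eval _ pol = 0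
      simp only [pol, Polynomial.eval_sub, Polynomial.eval_mul, Polynomial.eval_C,
        Polynomial.eval_pow, Polynomial.eval_X, Polynomial.eval_finsetSum]
      rw [← h1, Finset.sum_mul, ← Finset.sum_sub_distrib]
      refine Finset.sum_eq_zero fun m hm => ?_
      have hb := hD m hm
      have e1 : algebraMap k K c ^ (D + α m - β m) * algebraMap k K c ^ β m =
          algebraMap k K c ^ D * algebraMap k K c ^ α m := by
        rw [← pow_add, ← pow_add]; congr 1; omega
      have e2 : algebraMap k K ((cu⁻¹ : kˣ) : k) = (algebraMap k K c)⁻¹ := by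
        simp [cu]
      have e3 : algebraMap k K c ^ (D + α m - β m) =
          algebraMap k K c ^ D * algebraMap k K c ^ α m * ((algebraMap k K c)⁻¹) ^ β m := by
        rw [← e1, inv_pow, mul_assoc, mul_inv_cancel₀ (pow_ne_zero _ hcK), mul_one]
      rw [e2, e3]
      simp only [cu, Units.val_mk0]
      ring
    have := congrArg (fun q => Polynomial.coeff q D) hpol
    simp only [pol, Polynomial.coeff_sub, Polynomial.finsetSum_coeff, Polynomial.coeff_C_mul_X_pow,
      Polynomial.coeff_zero, if_true] at this
    rw [sub_eq_zero] at this
    rw [← this, Finset.sum_filter]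
    refine Finset.sum_congr rfl fun m hm => ?_
    have hb := hD m hm
    have : (D = D + α m - β m) ↔ α m = β m := by omega
    simp only [this]
  have : (fun h => MvPolynomial.aeval (Sum.elim (y h) (Sum.elim (y' h) ξ)) r) =
      ∑ m ∈ r.support with α m = β m, mon m := by
    funext h
    rw [hF, hzero, Finset.sum_apply]
  rw [this]
  refine A.sum_mem fun m hm => ?_
  have hm' := (Finset.mem_filter.1 hm).2
  exact A.mul_mem (A.algebraMap_mem (algebraMap k K (r.coeff m)))
    (A.mul_mem (pair_mem A y y' hy _ _ hm') (A.algebraMap_mem (∏ l, ξ l ^ m (Sum.inr (Sum.inr l)))))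



/-- adjoint representation matrix -/
def AdM {n : ℕ} (K : Type) [Field K] [Algebra k K] (g : GL (Fin n) k) :
    Matrix (Fin n × Fin n) (Fin n × Fin n) K :=
  Matrix.of fun x y => algebraMap k K (g.1 x.1 y.1 * (g⁻¹ : GL (Fin n) k).1 y.2 x.2)

theorem AdM_mul {n : ℕ} (K : Type) [Field K] [Algebra k K] (g h : GL (Fin n) k) :
    AdM k K (g * h) = AdM k K g * AdM k K h := by
  ext x y
  simp only [AdM, Matrix.of_apply, Matrix.mul_apply, mul_inv_rev, Units.val_mul, ← map_mul, ← map_sum]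
  congr 1
  rw [Finset.sum_mul_sum, Fintype.sum_prod_type]
  refine Finset.sum_congr rfl fun a _ => Finset.sum_congr rfl fun b _ => ?_
  ring

theorem AdM_one {n : ℕ} (K : Type) [Field K] [Algebra k K] :
    AdM k K (1 : GL (Fin n) k) = 1 := by
  ext x y
  simp only [AdM, Matrix.of_apply, inv_one, Units.val_one, Matrix.one_apply, Prod.ext_iff]
  by_cases h1 : x.1 = y.1 <;> by_cases h2 : x.2 = y.2 <;> simp [h1, h2, Ne.symm]

theorem scalar_fix {n : ℕ} (V : PGLnVar k n)
    {K : Type} [Field K] [Algebra k K] [MulSemiringAction (GL (Fin n) k) K] (ξ : Fin V.N → K)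
    (hξ : ∀ r : MvPolynomial (Fin V.N) k, MvPolynomial.aeval ξ r = 0 ↔
        ∀ v ∈ V.carrier, MvPolynomial.eval v r = 0)
    (hact : ∀ (g : GL (Fin n) k) j, g⁻¹ • ξ j =
        MvPolynomial.aeval (argL (cM k K g.1) (cM k K (g⁻¹ : GL (Fin n) k).1) ξ) (V.actP j))
    (c : kˣ) (j : Fin V.N) : (scalarGL k c : GL (Fin n) k)⁻¹ • ξ j = ξ j := by
  rw [hact]
  have key : ∀ {E : Type} [Field E] [Algebra k E] (e : Fin V.N → E),
      MvPolynomial.aeval e (MvPolynomial.aeval (argL (cM k (MvPolynomial (Fin V.N) k) (scalarGL k c).1)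
        (cM k _ ((scalarGL k c)⁻¹ : GL (Fin n) k).1) MvPolynomial.X) (V.actP j)) =
      MvPolynomial.aeval (argL (cM k E (scalarGL k c).1)
        (cM k E ((scalarGL k c)⁻¹ : GL (Fin n) k).1) e) (V.actP j) := by
    intro E _ _ e
    rw [← AlgHom.comp_apply, MvPolynomial.comp_aeval]
    congr 2
    funext l
    rcases l with l | l | l <;> simp [argL]
  have := (hξ (MvPolynomial.aeval (argL (cM k (MvPolynomial (Fin V.N) k) (scalarGL k c).1)
        (cM k _ ((scalarGL k c)⁻¹ : GL (Fin n) k).1) MvPolynomial.X) (V.actP j) - MvPolynomial.X j)).2 (by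
    intro v hv
    have h1 := congrFun (V.scalar_trivial c v hv) j
    rw [V.act_eval, ← MvPolynomial.aeval_eq_eval] at h1
    rw [← MvPolynomial.aeval_eq_eval]
    change MvPolynomial.aeval v _ = 0
    rw [map_sub, key, MvPolynomial.aeval_X, sub_eq_zero]
    exact h1)
  rw [map_sub, key, MvPolynomial.aeval_X, sub_eq_zero] at this
  exact this

theorem exists_equivariant {n : ℕ} (V : PGLnVar k n) (p : MvPolynomial (Fin V.N) k)
    (hp : ∀ v ∈ V.carrier, MvPolynomial.eval v p ≠ 0 →
      ∀ g : GL (Fin n) k, V.act g v = v → ∃ c : kˣ, g = scalarGL k c)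
    {K : Type} [Field K] [Algebra k K] [MulSemiringAction (GL (Fin n) k) K] (ξ : Fin V.N → K)
    (hfix : ∀ (g : GL (Fin n) k) (c : k), g • algebraMap k K c = algebraMap k K c)
    (hξ : ∀ r : MvPolynomial (Fin V.N) k, MvPolynomial.aeval ξ r = 0 ↔
        ∀ v ∈ V.carrier, MvPolynomial.eval v r = 0)
    (hact : ∀ (g : GL (Fin n) k) j, g⁻¹ • ξ j =
        MvPolynomial.aeval (argL (cM k K g.1) (cM k K (g⁻¹ : GL (Fin n) k).1) ξ) (V.actP j))
    (hpξ : MvPolynomial.aeval ξ p ≠ 0) :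
    ∃ (I : Type) (_ : Fintype I) (C : I → Matrix (Fin n × Fin n) (Fin n × Fin n) K) (f : I → K),
      (∀ (h : GL (Fin n) k) b, (C b).map (fun x => h • x) = AdM k K h⁻¹ * C b) ∧
      ∑ b, f b • C b = 1 := by
  obtain ⟨Q, P, hQP, g0, hg0⟩ := generic_rel k V p hp ξ (fun r hr => (hξ r).2 hr) hpξ
  have hw : ∀ g : GL (Fin n) k, (fun l => MvPolynomial.aeval
          (argL (cM k K (g⁻¹ : GL (Fin n) k).1) (cM k K g.1) ξ) (V.actP l)) = fun l => g • ξ l := by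
    intro g; funext l
    have := hact g⁻¹ l
    rw [inv_inv] at this
    exact this.symm
  have hspan := span_tf_eq (H := GL (Fin n) k) (⊤ : Submonoid K)
  simp only [Submonoid.coe_top, Set.image_univ] at hspan
  set A := Algebra.adjoin K (Set.range (tf (GL (Fin n) k) : K → _)) with hA
  have hmem : ∀ φ, φ ∈ A ↔ φ ∈ Submodule.span K (Set.range (tf (GL (Fin n) k) : K → _)) := by
    intro φ; rw [← hspan]; rfl
  have hpoly : ∀ r : MvPolynomial (Fin V.N ⊕ Fin V.N) k, (fun g : GL (Fin n) k => MvPolynomial.aeval (Sum.elim ξ (fun l => g • ξ l)) r) ∈ A := by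
    intro r
    refine aeval_mem_fun k A (fun g => Sum.elim ξ (fun l => g • ξ l)) ?_ r
    rintro (l | l)
    · exact A.algebraMap_mem (ξ l)
    · exact Algebra.subset_adjoin ⟨ξ l, rfl⟩
  have hT : ∀ i j, (fun g => AdM k K g i j) ∈ Submodule.span K (Set.range (tf (GL (Fin n) k) : K → _)) := by
    refine T_mem (AdM k K) (AdM_mul k K) (AdM_one k K) (fun g h i j => hfix _ _)
      (fun g : GL (Fin n) k => MvPolynomial.aeval (Sum.elim ξ (fun l => g • ξ l)) Q) ?_ ?_ ?_
    · intro h0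
      apply hg0
      have h1 := congrFun h0 g0⁻¹
      simp only [← hw, inv_inv] at h1
      exact h1
    · exact (hmem _).1 (hpoly Q)
    · rintro ⟨x, y⟩ ⟨z, w⟩
      rw [← hmem]
      convert hpoly (P ((w, z), (y, x))) using 1
      funext g
      have := hQP g⁻¹ w z y x
      rw [inv_inv, hw] at this
      rw [← this, Pi.mul_apply]
      simp only [AdM, Matrix.of_apply]
      rw [mul_comm (g.1 x z)]
  exact hilb90 (AdM k K) (AdM_mul k K) (AdM_one k K) (fun g h i j => hfix _ _) hT

theorem xi_mem {n : ℕ} (V : PGLnVar k n)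
    {K : Type} [Field K] [Algebra k K] [MulSemiringAction (GL (Fin n) k) K] (ξ : Fin V.N → K)
    (hξ : ∀ r : MvPolynomial (Fin V.N) k, MvPolynomial.aeval ξ r = 0 ↔
        ∀ v ∈ V.carrier, MvPolynomial.eval v r = 0)
    (hact : ∀ (g : GL (Fin n) k) j, g⁻¹ • ξ j =
        MvPolynomial.aeval (argL (cM k K g.1) (cM k K (g⁻¹ : GL (Fin n) k).1) ξ) (V.actP j))
    (A : Subalgebra K (GL (Fin n) k → K))
    (hAd : ∀ x y, (fun h : GL (Fin n) k => AdM k K h⁻¹ x y) ∈ A) (j : Fin V.N) :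
    tf (GL (Fin n) k) (ξ j) ∈ A := by
  let y : GL (Fin n) k → Fin n × Fin n → K := fun h z => cM k K (h⁻¹ : GL (Fin n) k).1 z.1 z.2
  let y' : GL (Fin n) k → Fin n × Fin n → K := fun h z => cM k K h.1 z.1 z.2
  have e : tf (GL (Fin n) k) (ξ j) = fun h => MvPolynomial.aeval
      (Sum.elim (y h) (Sum.elim (y' h) ξ)) (V.actP j) := by
    funext h
    have := hact h⁻¹ j
    rw [inv_inv] at this
    exact this
  rw [e]
  refine weight_zero k A y y' ?_ ξ (V.actP j) ?_
  · intro z w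
    convert hAd (z.1, w.2) (z.2, w.1) using 1
    funext h
    simp only [AdM, Matrix.of_apply, inv_inv, map_mul, y, y', Matrix.map_apply]
  · intro h c
    have e1 := congrFun e h
    have e2 := congrFun e (h * (scalarGL k c)⁻¹)
    have e3 : tf (GL (Fin n) k) (ξ j) (h * (scalarGL k c)⁻¹) = tf (GL (Fin n) k) (ξ j) h := by
      change (h * (scalarGL k c)⁻¹) • ξ j = h • ξ j
      rw [mul_smul, scalar_fix k V ξ hξ hact]
    have hs : (scalarGL k c)⁻¹ = (scalarGL k c⁻¹ : GL (Fin n) k) := by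
      rw [scalarGL, scalarGL, map_inv]
    have hsm : ∀ d : kˣ, (scalarGL k d : GL (Fin n) k).1 = Matrix.diagonal (fun _ => (d : k)) := by
      intro d
      exact Matrix.algebraMap_eq_diagonal _
    have hy1 : ∀ z, y (h * (scalarGL k c)⁻¹) z = algebraMap k K c * y h z := by
      intro z
      simp only [y, mul_inv_rev, inv_inv, Units.val_mul, hsm, Matrix.map_apply,
        Matrix.diagonal_mul, map_mul]
    have hy2 : ∀ z, y' (h * (scalarGL k c)⁻¹) z = algebraMap k K (c⁻¹ : kˣ) * y' h z := by
      intro z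
      simp only [y', hs, Units.val_mul, hsm, Matrix.map_apply,
        Matrix.mul_diagonal, map_mul]
      rw [mul_comm]
    have hy1' : y (h * (scalarGL k c)⁻¹) = fun z => algebraMap k K c * y h z := funext hy1
    have hy2' : y' (h * (scalarGL k c)⁻¹) = fun z => algebraMap k K (c⁻¹ : kˣ) * y' h z := funext hy2
    rw [← e1, ← e3, e2, hy1', hy2']

theorem alg_main {n : ℕ} (hn : 1 ≤ n) (V : PGLnVar k n) (p : MvPolynomial (Fin V.N) k)
    (hp : ∀ v ∈ V.carrier, MvPolynomial.eval v p ≠ 0 →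
      ∀ g : GL (Fin n) k, V.act g v = v → ∃ c : kˣ, g = scalarGL k c)
    {K : Type} [Field K] [Algebra k K] [MulSemiringAction (GL (Fin n) k) K] (ξ : Fin V.N → K)
    (hfix : ∀ (g : GL (Fin n) k) (c : k), g • algebraMap k K c = algebraMap k K c)
    (hξ : ∀ r : MvPolynomial (Fin V.N) k, MvPolynomial.aeval ξ r = 0 ↔
        ∀ v ∈ V.carrier, MvPolynomial.eval v r = 0)
    (hact : ∀ (g : GL (Fin n) k) j, g⁻¹ • ξ j =
        MvPolynomial.aeval (argL (cM k K g.1) (cM k K (g⁻¹ : GL (Fin n) k).1) ξ) (V.actP j))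
    (hpξ : MvPolynomial.aeval ξ p ≠ 0) :
    ∃ (m : ℕ) (_ : 2 ≤ m) (x : Fin m → Matrix (Fin n) (Fin n) K) (a : Fin n × Fin n → Fin m → K)
      (u : Fin V.N → PolyRing k n m) (d : PolyRing k n m),
      (∀ (g : GL (Fin n) k) i, (x i).map (fun y => g • y) =
        cM k K (g⁻¹ : GL (Fin n) k).1 * x i * cM k K g.1) ∧
      (∀ z, ∑ i, a z i • x i = Matrix.single z.1 z.2 1) ∧
      MvPolynomial.aeval (fun z : MIdx n m => x z.1 z.2.1 z.2.2) d ≠ 0 ∧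
      ∀ j, MvPolynomial.aeval (fun z : MIdx n m => x z.1 z.2.1 z.2.2) d * ξ j =
        MvPolynomial.aeval (fun z : MIdx n m => x z.1 z.2.1 z.2.2) (u j) := by
  classical
  obtain ⟨I, _, C, f, hC, hf⟩ := exists_equivariant k V p hp ξ hfix hξ hact hpξ
  let H := GL (Fin n) k
  let M := Fin n × Fin n
  let F : Subfield K := FixedPoints.subfield H K
  let E : Set K := Set.range (fun z : I × M × M => C z.1 z.2.1 z.2.2)
  let K0 : IntermediateField k K := IntermediateField.adjoin k ((F : Set K) ∪ E)
  have hFK : ∀ y ∈ F, y ∈ K0 := fun y hy => IntermediateField.subset_adjoin _ _ (Or.inl hy)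
  have hEK : ∀ b z w, C b z w ∈ K0 := fun b z w =>
    IntermediateField.subset_adjoin _ _ (Or.inr ⟨(b, z, w), rfl⟩)
  let W : Submodule F K :=
    { carrier := K0
      add_mem' := fun ha hb => K0.add_mem ha hb
      zero_mem' := K0.zero_mem
      smul_mem' := fun c y hy => K0.mul_mem (hFK c.1 c.2) hy }
  let A := Algebra.adjoin K (tf H '' (K0 : Set K))
  have hA : Subalgebra.toSubmodule A = Submodule.span K (tf H '' (W : Set K)) :=
    span_tf_eq (H := H) K0.toSubfield.toSubmonoid
  have hAd : ∀ x y, (fun h : H => AdM k K h⁻¹ x y) ∈ A := by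
    intro x y
    have : (fun h : H => AdM k K h⁻¹ x y) = ∑ b, f b • tf H (C b x y) := by
      funext h
      have h1 : AdM k K h⁻¹ = ∑ b, f b • (C b).map (fun x => h • x) := by
        simp only [hC, ← Matrix.mul_smul, ← Matrix.mul_sum, hf, Matrix.mul_one]
      rw [h1, Matrix.sum_apply, Finset.sum_apply]
      rfl
    rw [this]
    exact A.sum_mem fun b _ => A.smul_mem (Algebra.subset_adjoin ⟨_, hEK b x y, rfl⟩) _
  have hξK : ∀ j, ξ j ∈ K0 := by
    intro j
    refine tf_descent W (ξ j) ?_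
    rw [← hA]
    exact xi_mem k V ξ hξ hact A hAd j
  -- finitely many invariants
  choose Tj hTj hξT using fun j => IntermediateField.exists_finset_of_mem_adjoin (hξK j)
  let G : Finset K := (Finset.univ.biUnion Tj).filter (· ∈ F)
  have hG : ∀ y ∈ G, y ∈ F := fun y hy => (Finset.mem_filter.1 hy).2
  let J := (I × M) ⊕ (G ⊕ Fin 2)
  let m := Fintype.card J
  let e : Fin m ≃ J := (Fintype.equivFin J).symm
  let xJ : J → Matrix (Fin n) (Fin n) K := Sum.elim (fun z => Matrix.of fun i j => C z.1 (i, j) z.2)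
    (Sum.elim (fun y => Matrix.scalar (Fin n) y.1) (fun _ => 0))
  have hm : 2 ≤ m := by
    simp only [m, J, Fintype.card_sum, Fintype.card_fin]; omega
  let x : Fin m → Matrix (Fin n) (Fin n) K := fun i => xJ (e i)
  let ent : MIdx n m → K := fun z => x z.1 z.2.1 z.2.2
  have hadj : ∀ j, ξ j ∈ IntermediateField.adjoin k (Set.range ent) := by
    intro j
    refine (IntermediateField.adjoin.mono k _ _ ?_) (hξT j)
    intro y hy
    rcases hTj j hy with h | ⟨z, rfl⟩
    · have hyG : y ∈ G := Finset.mem_filter.2 ⟨Finset.mem_biUnion.2 ⟨j, Finset.mem_univ _, hy⟩, h⟩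
      refine ⟨(e.symm (Sum.inr (Sum.inl ⟨y, hyG⟩)), ⟨0, hn⟩, ⟨0, hn⟩), ?_⟩
      simp [ent, x, xJ]
    · refine ⟨(e.symm (Sum.inl (z.1, z.2.2)), z.2.1.1, z.2.1.2), ?_⟩
      simp [ent, x, xJ]
  obtain ⟨d, u, hd, hu⟩ := common_den (MvPolynomial.aeval ent : _ →ₐ[k] K).toRingHom ξ (by
      intro j
      obtain ⟨r, s, hrs⟩ := (IntermediateField.mem_adjoin_range_iff (F := k) ent _).1 (hadj j)
      by_cases hs : MvPolynomial.aeval ent s = 0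
      · exact ⟨0, 1, by simp, by simp [hrs, hs]⟩
      · exact ⟨r, s, hs, by rw [hrs]; exact mul_div_cancel₀ _ hs⟩)
  let aJ : M → J → K := fun z => Sum.elim (fun w => if w.2 = z then f w.1 else 0) (fun _ => 0)
  refine ⟨m, hm, x, fun z i => aJ z (e i), u, d, ?_, ?_, hd, hu⟩
  · intro g i
    simp only [x]
    rcases e i with ⟨b, w⟩ | y | t
    · ext r s
      have h1 := congrFun (congrFun (hC g b) (r, s)) w
      simp only [Matrix.map_apply] at h1
      simp only [xJ, Sum.elim_inl, Matrix.map_apply, Matrix.of_apply]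
      rw [h1, Matrix.mul_apply, Matrix.mul_apply, Fintype.sum_prod_type_right]
      refine Finset.sum_congr rfl fun t _ => ?_
      rw [Matrix.mul_apply, Finset.sum_mul]
      refine Finset.sum_congr rfl fun t' _ => ?_
      simp only [AdM, Matrix.of_apply, inv_inv, Matrix.map_apply, map_mul]
      ring
    · have hy : g • (y.1 : K) = y.1 := hG y.1 y.2 g
      have h1 : cM k K (g⁻¹ : GL (Fin n) k).1 * cM k K g.1 = 1 := by
        have : cM k K (g⁻¹ : GL (Fin n) k).1 * cM k K g.1 = cM k K ((g⁻¹ : GL (Fin n) k).1 * g.1) :=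
          (Matrix.map_mul).symm
        rw [this, show (g⁻¹ : GL (Fin n) k).1 * g.1 = 1 from g.inv_mul]
        exact Matrix.map_one _ (map_zero _) (map_one _)
      simp only [xJ, Sum.elim_inr, Sum.elim_inl]
      have h2 : cM k K (g⁻¹ : GL (Fin n) k).1 * Matrix.scalar (Fin n) y.1 =
          Matrix.scalar (Fin n) y.1 * cM k K (g⁻¹ : GL (Fin n) k).1 :=
        ((Matrix.scalar_commute y.1 (fun r => mul_comm _ _) _).eq).symm
      rw [h2, Matrix.mul_assoc, h1, Matrix.mul_one]
      ext r s
      by_cases hrs : r = s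
      · subst hrs; simp [hy]
      · simp [hrs]
    · ext r s
      simp [xJ]
  · intro z
    have h1 : ∑ i, aJ z (e i) • x i = ∑ w : J, aJ z w • xJ w :=
      Equiv.sum_comp e (fun w => aJ z w • xJ w)
    rw [h1]
    ext r s
    have h2 := congrFun (congrFun hf (r, s)) z
    rw [Matrix.sum_apply] at h2
    have h3 : ∀ b, ∑ w : M, aJ z (Sum.inl (b, w)) * C b (r, s) w = f b * C b (r, s) z := by
      intro b
      rw [Finset.sum_eq_single z]
      · simp [aJ]
      · intro w _ hw; simp [aJ, hw]
      · simp
    have h4 : (∑ w : J, aJ z w • xJ w) r s = ∑ b, ∑ w : M, aJ z (Sum.inl (b, w)) * C b (r, s) w := by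
      rw [Matrix.sum_apply, Fintype.sum_sum_type, Fintype.sum_prod_type]
      have : ∑ t, (aJ z (Sum.inr t) • xJ (Sum.inr t)) r s = 0 :=
        Finset.sum_eq_zero fun t _ => by simp [aJ]
      rw [this, add_zero]
      rfl
    rw [h4, Finset.sum_congr rfl fun b _ => h3 b]
    refine (Eq.trans ?_ h2).trans ?_
    · rfl
    · simp only [Matrix.single, Matrix.of_apply, Matrix.one_apply]
      congr 1
      simp only [Prod.ext_iff, eq_iff_iff]
      constructor
      · rintro ⟨h, h'⟩; exact ⟨h.symm, h'.symm⟩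
      · rintro ⟨h, h'⟩; exact ⟨h.symm, h'.symm⟩



theorem smul_aeval {H K σ : Type} [Group H] [Field K] [Algebra k K] [MulSemiringAction H K]
    (hfix : ∀ (g : H) (c : k), g • algebraMap k K c = algebraMap k K c) (g : H) (y : σ → K)
    (r : MvPolynomial σ k) :
    g • MvPolynomial.aeval y r = MvPolynomial.aeval (fun z => g • y z) r := by
  induction r using MvPolynomial.induction_on with
  | C c => simp [hfix]
  | add p q hp hq => simp [smul_add, hp, hq]
  | mul_X p i hp => simp [smul_mul', hp]

/-- conjugated coordinates -/
def cjP {n m : ℕ} (g : GL (Fin n) k) : MIdx n m → PolyRing k n m := fun z =>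
  (cM k (PolyRing k n m) g.1 * genericMatrix k n m z.1 *
    cM k (PolyRing k n m) (g⁻¹ : GL (Fin n) k).1) z.2.1 z.2.2

theorem aeval_cjP {n m : ℕ} (g : GL (Fin n) k) {K : Type} [Field K] [Algebra k K]
    (x : Fin m → Matrix (Fin n) (Fin n) K) (z : MIdx n m) :
    MvPolynomial.aeval (fun z : MIdx n m => x z.1 z.2.1 z.2.2) (cjP k g z) =
      (cM k K g.1 * x z.1 * cM k K (g⁻¹ : GL (Fin n) k).1) z.2.1 z.2.2 := by
  simp [cjP, Matrix.mul_apply, genericMatrix]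

/-- action polynomials with fixed group element -/
def actgP {n : ℕ} (V : PGLnVar k n) (g : GL (Fin n) k) : Fin V.N → MvPolynomial (Fin V.N) k := fun j =>
  MvPolynomial.aeval (argL (cM k (MvPolynomial (Fin V.N) k) g.1)
        (cM k _ (g⁻¹ : GL (Fin n) k).1) MvPolynomial.X) (V.actP j)

theorem aeval_actgP {n : ℕ} (V : PGLnVar k n) (g : GL (Fin n) k) {E : Type} [Field E] [Algebra k E]
    (e : Fin V.N → E) (j : Fin V.N) : MvPolynomial.aeval e (actgP k V g j) =
      MvPolynomial.aeval (argL (cM k E g.1) (cM k E (g⁻¹ : GL (Fin n) k).1) e) (V.actP j) := by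
  rw [actgP, ← AlgHom.comp_apply, MvPolynomial.comp_aeval]
  congr 2
  funext l
  rcases l with l | l | l <;> simp [argL]

theorem eval_actgP {n : ℕ} (V : PGLnVar k n) (g : GL (Fin n) k) (v : Fin V.N → k) (j : Fin V.N) :
    MvPolynomial.aeval v (actgP k V g j) = V.act g v j := by
  rw [aeval_actgP, V.act_eval, ← MvPolynomial.aeval_eq_eval]
  rfl

theorem conj_gen {n m : ℕ} (g : GL (Fin n) k) (b : MTuple k n m) (hb : b ∈ genTuples k n m) :
    conjAct k g b ∈ genTuples k n m := by
  let φ : Matrix (Fin n) (Fin n) k →ₐ[k] Matrix (Fin n) (Fin n) k :=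
    { toFun := fun y => g.1 * y * (g⁻¹ : GL (Fin n) k).1
      map_one' := by rw [mul_one]; exact g.mul_inv
      map_mul' := fun y z => by
        have : (g⁻¹ : GL (Fin n) k).1 * g.1 = 1 := g.inv_mul
        calc _ = g.1 * y * 1 * z * (g⁻¹ : GL (Fin n) k).1 := by simp only [mul_one, mul_assoc]
          _ = _ := by rw [← this]; simp only [mul_assoc]
      map_zero' := by simp
      map_add' := fun y z => by rw [mul_add, add_mul]
      commutes' := fun c => by
        rw [← Algebra.commutes c g.1, mul_assoc]
        have : g.1 * (g⁻¹ : GL (Fin n) k).1 = 1 := g.mul_inv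
        rw [this, mul_one] }
  have hsurj : Function.Surjective φ := by
    intro y
    refine ⟨(g⁻¹ : GL (Fin n) k).1 * y * g.1, ?_⟩
    change g.1 * ((g⁻¹ : GL (Fin n) k).1 * y * g.1) * (g⁻¹ : GL (Fin n) k).1 = y
    have : g.1 * (g⁻¹ : GL (Fin n) k).1 = 1 := g.mul_inv
    calc _ = (g.1 * (g⁻¹ : GL (Fin n) k).1) * y * (g.1 * (g⁻¹ : GL (Fin n) k).1) := by
          simp only [mul_assoc]
      _ = y := by rw [this, one_mul, mul_one]
  have h1 : Set.range (conjAct k g b) = φ '' Set.range b := by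
    rw [← Set.range_comp]; rfl
  change Algebra.adjoin k (Set.range (conjAct k g b)) = ⊤
  rw [h1, Algebra.adjoin_image]
  have hb' : Algebra.adjoin k (Set.range b) = ⊤ := hb
  rw [hb', Algebra.map_top]
  exact (AlgHom.range_eq_top φ).2 hsurj

theorem geom_main (n : ℕ)
    (V : PGLnVar k n)
    {K : Type} [Field K] [Algebra k K] [MulSemiringAction (GL (Fin n) k) K] (ξ : Fin V.N → K)
    (hfix : ∀ (g : GL (Fin n) k) (c : k), g • algebraMap k K c = algebraMap k K c)
    (hξ : ∀ r : MvPolynomial (Fin V.N) k, MvPolynomial.aeval ξ r = 0 ↔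
        ∀ v ∈ V.carrier, MvPolynomial.eval v r = 0)
    (hdiv : ∀ y : K, ∃ s t : MvPolynomial (Fin V.N) k, MvPolynomial.aeval ξ t ≠ 0 ∧
        MvPolynomial.aeval ξ t * y = MvPolynomial.aeval ξ s)
    (hact : ∀ (g : GL (Fin n) k) j, g⁻¹ • ξ j =
        MvPolynomial.aeval (argL (cM k K g.1) (cM k K (g⁻¹ : GL (Fin n) k).1) ξ) (V.actP j))
    (m : ℕ) (x : Fin m → Matrix (Fin n) (Fin n) K) (a : Fin n × Fin n → Fin m → K)
    (u : Fin V.N → PolyRing k n m) (d : PolyRing k n m)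
    (hxg : ∀ (g : GL (Fin n) k) i, (x i).map (fun y => g • y) =
        cM k K (g⁻¹ : GL (Fin n) k).1 * x i * cM k K g.1)
    (hax : ∀ z, ∑ i, a z i • x i = Matrix.single z.1 z.2 1)
    (hd : MvPolynomial.aeval (fun z : MIdx n m => x z.1 z.2.1 z.2.2) d ≠ 0)
    (hu : ∀ j, MvPolynomial.aeval (fun z : MIdx n m => x z.1 z.2.1 z.2.2) d * ξ j =
        MvPolynomial.aeval (fun z : MIdx n m => x z.1 z.2.1 z.2.2) (u j)) :
    ∃ X : Set (MTuple k n m),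
      IsNVariety k X ∧ IsIrredSubset k X ∧
      ∃ (p : Fin m → Matrix (Fin n) (Fin n) (MvPolynomial (Fin V.N) k))
        (q : MvPolynomial (Fin V.N) k)
        (u : Fin V.N → PolyRing k n m) (d : PolyRing k n m),
        (∃ v ∈ V.carrier, MvPolynomial.eval v q ≠ 0) ∧
        (∀ v ∈ V.carrier, MvPolynomial.eval v q ≠ 0 → affRatVal k p q v ∈ X) ∧
        (∀ g : GL (Fin n) k, ∀ v ∈ V.carrier,
          MvPolynomial.eval v q ≠ 0 → MvPolynomial.eval (V.act g v) q ≠ 0 →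
          affRatVal k p q (V.act g v) = conjAct k g (affRatVal k p q v)) ∧
        (∃ x ∈ X, polyEval k x d ≠ 0) ∧
        (∀ x ∈ X, polyEval k x d ≠ 0 → matRatVal k u d x ∈ V.carrier) ∧
        (∀ g : GL (Fin n) k, ∀ x ∈ X,
          polyEval k x d ≠ 0 → polyEval k (conjAct k g x) d ≠ 0 →
          matRatVal k u d (conjAct k g x) = V.act g (matRatVal k u d x)) ∧
        (∃ v ∈ V.carrier, MvPolynomial.eval v q ≠ 0 ∧ polyEval k (affRatVal k p q v) d ≠ 0) ∧
        (∃ x ∈ X, polyEval k x d ≠ 0 ∧ MvPolynomial.eval (matRatVal k u d x) q ≠ 0) ∧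
        (∀ v ∈ V.carrier, MvPolynomial.eval v q ≠ 0 → polyEval k (affRatVal k p q v) d ≠ 0 →
          matRatVal k u d (affRatVal k p q v) = v) ∧
        (∀ x ∈ X, polyEval k x d ≠ 0 → MvPolynomial.eval (matRatVal k u d x) q ≠ 0 →
          affRatVal k p q (matRatVal k u d x) = x) := by
  classical
  set ent : MIdx n m → K := fun z => x z.1 z.2.1 z.2.2 with hent
  let entk : MTuple k n m → MIdx n m → k := fun b z => b z.1 z.2.1 z.2.2
  have hpe : ∀ b P, polyEval k b P = MvPolynomial.aeval (entk b) P := fun b P => rfl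
  have hev : ∀ (v : Fin V.N → k) r, MvPolynomial.eval v r = MvPolynomial.aeval v r := fun v r => by
    rw [MvPolynomial.aeval_eq_eval]
  simp only [hpe, hev] at hξ ⊢
  -- common denominator
  obtain ⟨q, s, hq, hs⟩ := common_den (MvPolynomial.aeval ξ : _ →ₐ[k] K).toRingHom
    (Sum.elim ent (fun z : (Fin n × Fin n) × Fin m => a z.1 z.2)) (fun i => hdiv _)
  have hq' : MvPolynomial.aeval ξ q ≠ 0 := hq
  have hsx : ∀ z, MvPolynomial.aeval ξ q * ent z = MvPolynomial.aeval ξ (s (Sum.inl z)) :=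
    fun z => hs (Sum.inl z)
  have hsa : ∀ z i, MvPolynomial.aeval ξ q * a z i = MvPolynomial.aeval ξ (s (Sum.inr (z, i))) :=
    fun z i => hs (Sum.inr (z, i))
  let p : Fin m → Matrix (Fin n) (Fin n) (MvPolynomial (Fin V.N) k) :=
    fun i => Matrix.of fun r t => s (Sum.inl (i, r, t))
  let f : (Fin V.N → k) → MTuple k n m := affRatVal k p q
  have hf : ∀ v z, entk (f v) z = (MvPolynomial.aeval v q)⁻¹ * MvPolynomial.aeval v (s (Sum.inl z)) := by
    intro v z; rw [← hev, ← hev]; rfl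
  let h : MTuple k n m → (Fin V.N → k) := matRatVal k u d
  have hh : ∀ b j, h b j = (MvPolynomial.aeval (entk b) d)⁻¹ * MvPolynomial.aeval (entk b) (u j) :=
    fun b j => rfl
  -- specialization at points of V
  have hle1 : ∀ v ∈ V.carrier, ∀ r : MvPolynomial (Fin V.N) k, MvPolynomial.aeval ξ r = 0 →
      MvPolynomial.aeval v r = 0 := fun v hv r hr => (hξ r).1 hr v hv
  have hxy1 : ∀ v : Fin V.N → k, MvPolynomial.aeval v q ≠ 0 → ∀ i : MIdx n m ⊕ Fin V.N,
      ∃ s t : MvPolynomial (Fin V.N) k, MvPolynomial.aeval v t ≠ 0 ∧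
        MvPolynomial.aeval ξ t * Sum.elim ent ξ i = MvPolynomial.aeval ξ s ∧
        MvPolynomial.aeval v t * Sum.elim (entk (f v)) v i = MvPolynomial.aeval v s := by
    intro v hqv i
    rcases i with z | j
    · refine ⟨s (Sum.inl z), q, hqv, hsx z, ?_⟩
      rw [Sum.elim_inl, hf, mul_inv_cancel_left₀ hqv]
    · exact ⟨MvPolynomial.X j, 1, by simp, by simp, by simp⟩
  have hS1 : ∀ v ∈ V.carrier, MvPolynomial.aeval v q ≠ 0 → ∀ r : MvPolynomial (MIdx n m ⊕ Fin V.N) k,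
      MvPolynomial.aeval (Sum.elim ent ξ) r = 0 → MvPolynomial.aeval (Sum.elim (entk (f v)) v) r = 0 :=
    fun v hv hqv r hr => aux_spec (MvPolynomial.aeval ξ) (MvPolynomial.aeval v) (hle1 v hv) _ _
      (hxy1 v hqv) r hr
  have hpt : ∀ D : PolyRing k n m, MvPolynomial.aeval ent D ≠ 0 →
      ∃ v ∈ V.carrier, MvPolynomial.aeval v q ≠ 0 ∧ MvPolynomial.aeval (entk (f v)) D ≠ 0 := by
    intro D hD
    obtain ⟨s', t', ht', hst⟩ := hdiv (MvPolynomial.aeval ent D)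
    have hs' : MvPolynomial.aeval ξ (s' * q) ≠ 0 := by
      rw [map_mul, ← hst]
      exact mul_ne_zero (mul_ne_zero ht' hD) hq'
    have hex : ∃ v ∈ V.carrier, MvPolynomial.aeval v (s' * q) ≠ 0 := by
      by_contra hcon
      push Not at hcon
      exact hs' ((hξ _).2 hcon)
    obtain ⟨v, hv, hne⟩ := hex
    rw [map_mul] at hne
    have hqv := right_ne_zero_of_mul hne
    refine ⟨v, hv, hqv, fun h0 => left_ne_zero_of_mul hne ?_⟩
    have := aux_spec_val (MvPolynomial.aeval ξ) (MvPolynomial.aeval v) (hle1 v hv) _ _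
      (hxy1 v hqv) (MvPolynomial.rename Sum.inl D) s' t' (by
        rw [MvPolynomial.aeval_rename, Sum.elim_comp_inl]; exact hst)
    rw [MvPolynomial.aeval_rename, Sum.elim_comp_inl, h0, mul_zero] at this
    exact this.symm
  have hgen : ∀ v ∈ V.carrier, MvPolynomial.aeval v q ≠ 0 → f v ∈ genTuples k n m := by
    intro v hv hqv
    let ak : Fin n × Fin n → Fin m → k := fun z i =>
      (MvPolynomial.aeval v q)⁻¹ * MvPolynomial.aeval v (s (Sum.inr (z, i)))
    have hsum : ∀ z, ∑ i, ak z i • f v i = Matrix.single z.1 z.2 1 := by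
      intro z
      ext r t
      have h1 := congrFun (congrFun (hax z) r) t
      have := aux_spec (MvPolynomial.aeval ξ) (MvPolynomial.aeval v) (hle1 v hv)
        (Sum.elim (a z) ent) (Sum.elim (ak z) (entk (f v))) (by
          rintro (i | w)
          · refine ⟨s (Sum.inr (z, i)), q, hqv, hsa z i, ?_⟩
            rw [Sum.elim_inl, mul_inv_cancel_left₀ hqv]
          · refine ⟨s (Sum.inl w), q, hqv, hsx w, ?_⟩
            rw [Sum.elim_inr, hf, mul_inv_cancel_left₀ hqv])
        (∑ i, MvPolynomial.X (Sum.inl i) * MvPolynomial.X (Sum.inr (i, r, t)) -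
          MvPolynomial.C (Matrix.single z.1 z.2 (1 : k) r t)) (by
          rw [Matrix.sum_apply] at h1
          simp only [map_sub, map_sum, map_mul, MvPolynomial.aeval_X, MvPolynomial.aeval_C,
            Sum.elim_inl, Sum.elim_inr]
          rw [sub_eq_zero]
          refine Eq.trans ?_ (h1.trans ?_)
          · rfl
          · simp only [Matrix.single, Matrix.of_apply]
            split_ifs <;> simp)
      simp only [map_sub, map_sum, map_mul, MvPolynomial.aeval_X, MvPolynomial.aeval_C,
            Sum.elim_inl, Sum.elim_inr] at this
      rw [sub_eq_zero] at this
      rw [Matrix.sum_apply]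
      exact this
    change Algebra.adjoin k (Set.range (f v)) = ⊤
    rw [eq_top_iff]
    intro y _
    rw [Matrix.matrix_eq_sum_single y]
    refine Subalgebra.sum_mem _ fun r _ => Subalgebra.sum_mem _ fun t _ => ?_
    have e : Matrix.single r t (y r t) = y r t • Matrix.single r t (1 : k) := by
      rw [Matrix.smul_single, smul_eq_mul, mul_one]
    rw [e, ← hsum (r, t)]
    exact Subalgebra.smul_mem _ (Subalgebra.sum_mem _ fun i _ => Subalgebra.smul_mem _
      (Algebra.subset_adjoin (Set.mem_range_self i)) _) _
  let C : Set (MTuple k n m) := {b | ∀ P ∈ {P : PolyRing k n m | MvPolynomial.aeval ent P = 0},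
    polyEval k b P = 0}
  let X : Set (MTuple k n m) := C ∩ genTuples k n m
  have hX0 : ∀ b ∈ X, ∀ P, MvPolynomial.aeval ent P = 0 → MvPolynomial.aeval (entk b) P = 0 :=
    fun b hb P hP => hb.1 P hP
  have hfX : ∀ v ∈ V.carrier, MvPolynomial.aeval v q ≠ 0 → f v ∈ X := by
    intro v hv hqv
    refine ⟨fun P hP => ?_, hgen v hv hqv⟩
    have := hS1 v hv hqv (MvPolynomial.rename Sum.inl P) (by
      rw [MvPolynomial.aeval_rename, Sum.elim_comp_inl]; exact hP)
    rw [MvPolynomial.aeval_rename, Sum.elim_comp_inl] at this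
    exact this
  -- specialization at points of X
  have hS2 : ∀ b ∈ X, MvPolynomial.aeval (entk b) d ≠ 0 → ∀ r : MvPolynomial (MIdx n m ⊕ Fin V.N) k,
      MvPolynomial.aeval (Sum.elim ent ξ) r = 0 → MvPolynomial.aeval (Sum.elim (entk b) (h b)) r = 0 := by
    intro b hb hdb r hr
    refine aux_spec (MvPolynomial.aeval ent) (MvPolynomial.aeval (entk b)) (hX0 b hb) _ _ ?_ r hr
    rintro (z | j)
    · exact ⟨MvPolynomial.X z, 1, by simp, by simp, by simp⟩
    · refine ⟨u j, d, hdb, hu j, ?_⟩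
      rw [Sum.elim_inr, hh, mul_inv_cancel_left₀ hdb]
  -- group action on K
  have hcj : ∀ (g : GL (Fin n) k) z, MvPolynomial.aeval ent (cjP k g z) = g⁻¹ • ent z := by
    intro g z
    rw [hent, aeval_cjP]
    have := congrFun (congrFun (hxg g⁻¹ z.1) z.2.1) z.2.2
    rw [inv_inv] at this
    exact this.symm
  have hcj' : ∀ (g : GL (Fin n) k) (P : PolyRing k n m), MvPolynomial.aeval ent (MvPolynomial.aeval (cjP k g) P) =
      g⁻¹ • MvPolynomial.aeval ent P := by
    intro g P
    rw [smul_aeval k hfix, ← AlgHom.comp_apply, MvPolynomial.comp_aeval]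
    congr 2
    funext z
    exact hcj g z
  have hcjk : ∀ (g : GL (Fin n) k) (b : MTuple k n m) z,
      MvPolynomial.aeval (entk b) (cjP k g z) = entk (conjAct k g b) z := by
    intro g b z
    rw [aeval_cjP]
    simp [entk, conjAct, cM]
  have hcjk' : ∀ (g : GL (Fin n) k) (b : MTuple k n m) (P : PolyRing k n m),
      MvPolynomial.aeval (entk b) (MvPolynomial.aeval (cjP k g) P) =
      MvPolynomial.aeval (entk (conjAct k g b)) P := by
    intro g b P
    rw [← AlgHom.comp_apply, MvPolynomial.comp_aeval]
    congr 2
    funext z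
    exact hcjk g b z
  have hac : ∀ (g : GL (Fin n) k) j, MvPolynomial.aeval ξ (actgP k V g j) = g⁻¹ • ξ j := by
    intro g j; rw [aeval_actgP, hact]
  have hac' : ∀ (g : GL (Fin n) k) (R : MvPolynomial (Fin V.N) k),
      MvPolynomial.aeval ξ (MvPolynomial.aeval (actgP k V g) R) = g⁻¹ • MvPolynomial.aeval ξ R := by
    intro g R
    rw [smul_aeval k hfix, ← AlgHom.comp_apply, MvPolynomial.comp_aeval]
    congr 2
    funext z
    exact hac g z
  have hack' : ∀ (g : GL (Fin n) k) (v : Fin V.N → k) (R : MvPolynomial (Fin V.N) k),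
      MvPolynomial.aeval v (MvPolynomial.aeval (actgP k V g) R) = MvPolynomial.aeval (V.act g v) R := by
    intro g v R
    rw [← AlgHom.comp_apply, MvPolynomial.comp_aeval]
    congr 2
    funext z
    exact eval_actgP k V g v z
  obtain ⟨v0, hv0, hqv0, hdv0⟩ := hpt d hd
  have hinv1 : ∀ v ∈ V.carrier, MvPolynomial.aeval v q ≠ 0 → MvPolynomial.aeval (entk (f v)) d ≠ 0 →
      h (f v) = v := by
    intro v hv hqv hdv
    funext j
    have := hS1 v hv hqv (MvPolynomial.rename Sum.inl d * MvPolynomial.X (Sum.inr j) -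
      MvPolynomial.rename Sum.inl (u j)) (by
        simp only [map_sub, map_mul, MvPolynomial.aeval_rename, Sum.elim_comp_inl, MvPolynomial.aeval_X,
          Sum.elim_inr, hu, sub_self])
    simp only [map_sub, map_mul, MvPolynomial.aeval_rename, Sum.elim_comp_inl, MvPolynomial.aeval_X,
          Sum.elim_inr, sub_eq_zero] at this
    rw [hh, ← this, inv_mul_cancel_left₀ hdv]
  have hent_ext : ∀ b b' : MTuple k n m, (∀ z, entk b z = entk b' z) → b = b' := by
    intro b b' hbb
    funext i; ext r t; exact hbb (i, r, t)
  refine ⟨X, ⟨Set.inter_subset_right, ?_, C, ⟨_, rfl⟩, rfl⟩, ⟨⟨f v0, hfX v0 hv0 hqv0⟩, ?_⟩,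
    p, q, u, d, ⟨v0, hv0, hqv0⟩, hfX, ?_, ⟨f v0, hfX v0 hv0 hqv0, hdv0⟩, ?_, ?_,
    ⟨v0, hv0, hqv0, hdv0⟩, ⟨f v0, hfX v0 hv0 hqv0, hdv0, ?_⟩, hinv1, ?_⟩
  · intro g b hb
    refine ⟨fun P hP => ?_, conj_gen k g b hb.2⟩
    rw [hpe, ← hcjk']
    apply hX0 b hb
    rw [hcj', show MvPolynomial.aeval ent P = 0 from hP, smul_zero]
  · rintro _ _ ⟨S1, rfl⟩ ⟨S2, rfl⟩ hsub
    by_contra hcon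
    rw [not_or, Set.not_subset, Set.not_subset] at hcon
    obtain ⟨⟨b1, hb1, hn1⟩, ⟨b2, hb2, hn2⟩⟩ := hcon
    simp only [Set.mem_setOf_eq, not_forall] at hn1 hn2
    obtain ⟨P1, hP1, hne1⟩ := hn1
    obtain ⟨P2, hP2, hne2⟩ := hn2
    have h1 : MvPolynomial.aeval ent P1 ≠ 0 := fun h0 => hne1 (hX0 b1 hb1 P1 h0)
    have h2 : MvPolynomial.aeval ent P2 ≠ 0 := fun h0 => hne2 (hX0 b2 hb2 P2 h0)
    obtain ⟨v, hv, hqv, hne⟩ := hpt (P1 * P2) (by rw [map_mul]; exact mul_ne_zero h1 h2)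
    rw [map_mul] at hne
    rcases hsub (hfX v hv hqv) with h' | h'
    · exact left_ne_zero_of_mul hne (h' P1 hP1)
    · exact right_ne_zero_of_mul hne (h' P2 hP2)
  · intro g v hv hqv hqgv
    apply hent_ext
    intro z
    have := hS1 v hv hqv (MvPolynomial.rename Sum.inr (MvPolynomial.aeval (actgP k V g) q) *
      MvPolynomial.rename Sum.inl (cjP k g z) -
      MvPolynomial.rename Sum.inr (MvPolynomial.aeval (actgP k V g) (s (Sum.inl z)))) (by
        simp only [map_sub, map_mul, MvPolynomial.aeval_rename, Sum.elim_comp_inl,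
          Sum.elim_comp_inr, hac', hcj, ← smul_mul', hsx, sub_self])
    simp only [map_sub, map_mul, MvPolynomial.aeval_rename, Sum.elim_comp_inl,
          Sum.elim_comp_inr, hack', hcjk, sub_eq_zero] at this
    refine (hf _ z).trans ?_
    rw [← this, inv_mul_cancel_left₀ hqgv]
  · intro b hb hdb
    obtain ⟨S, hS⟩ := V.closed
    have hmem : ∀ v, v ∈ V.carrier ↔ ∀ R ∈ S, MvPolynomial.aeval v R = 0 := by
      intro v
      rw [hS]
      simp only [Set.mem_setOf_eq, hev]
    rw [hmem]
    intro R hR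
    have := hS2 b hb hdb (MvPolynomial.rename Sum.inr R) (by
      rw [MvPolynomial.aeval_rename, Sum.elim_comp_inr]
      exact (hξ R).2 fun v hv => (hmem v).1 hv R hR)
    rw [MvPolynomial.aeval_rename, Sum.elim_comp_inr] at this
    exact this
  · intro g b hb hdb hdgb
    funext j
    have := hS2 b hb hdb (MvPolynomial.rename Sum.inl (MvPolynomial.aeval (cjP k g) d) *
      MvPolynomial.rename Sum.inr (actgP k V g j) -
      MvPolynomial.rename Sum.inl (MvPolynomial.aeval (cjP k g) (u j))) (by
        simp only [map_sub, map_mul, MvPolynomial.aeval_rename, Sum.elim_comp_inl,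
          Sum.elim_comp_inr, hac, hcj', ← smul_mul', hu, sub_self])
    simp only [map_sub, map_mul, MvPolynomial.aeval_rename, Sum.elim_comp_inl,
          Sum.elim_comp_inr, hcjk', eval_actgP, sub_eq_zero] at this
    refine (hh _ j).trans ?_
    rw [← this, inv_mul_cancel_left₀ hdgb]
  · change MvPolynomial.aeval (h (f v0)) q ≠ 0
    rw [hinv1 v0 hv0 hqv0 hdv0]
    exact hqv0
  · intro b hb hdb hqb
    apply hent_ext
    intro z
    have := hS2 b hb hdb (MvPolynomial.rename Sum.inr q * MvPolynomial.X (Sum.inl z) -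
      MvPolynomial.rename Sum.inr (s (Sum.inl z))) (by
        simp only [map_sub, map_mul, MvPolynomial.aeval_rename, Sum.elim_comp_inr, MvPolynomial.aeval_X,
          Sum.elim_inl, hsx, sub_self])
    simp only [map_sub, map_mul, MvPolynomial.aeval_rename, Sum.elim_comp_inr, MvPolynomial.aeval_X,
          Sum.elim_inl, sub_eq_zero] at this
    refine (hf _ z).trans ?_
    rw [← this]
    exact inv_mul_cancel_left₀ hqb _




/-- **Statement 19** (Lemma lem.rat3).  Every irreducible generically free
`PGL_n`-variety `V` is birationally isomorphic, as a `PGL_n`-variety, to an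
irreducible `n`-variety in `U_{m,n}` for some `m ≥ 2`: there are mutually
inverse `PGL_n`-equivariant rational maps `V ⇢ X` and `X ⇢ V`. -/
theorem generically_free_birational_to_n_variety (n : ℕ) (hn : 1 ≤ n)
    (V : PGLnVar k n) (hirr : V.IsIrr) (hfree : V.IsGenericallyFree) :
    ∃ (m : ℕ), 2 ≤ m ∧ ∃ X : Set (MTuple k n m),
      IsNVariety k X ∧ IsIrredSubset k X ∧
      ∃ (p : Fin m → Matrix (Fin n) (Fin n) (MvPolynomial (Fin V.N) k))
        (q : MvPolynomial (Fin V.N) k)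
        (u : Fin V.N → PolyRing k n m) (d : PolyRing k n m),
        -- f = (1/q)·p is a rational map V ⇢ X, defined somewhere on V
        (∃ v ∈ V.carrier, MvPolynomial.eval v q ≠ 0) ∧
        (∀ v ∈ V.carrier, MvPolynomial.eval v q ≠ 0 → affRatVal k p q v ∈ X) ∧
        -- f is PGL_n-equivariant
        (∀ g : GL (Fin n) k, ∀ v ∈ V.carrier,
          MvPolynomial.eval v q ≠ 0 → MvPolynomial.eval (V.act g v) q ≠ 0 →
          affRatVal k p q (V.act g v) = conjAct k g (affRatVal k p q v)) ∧
        -- h = (1/d)·u is a rational map X ⇢ V, defined somewhere on X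
        (∃ x ∈ X, polyEval k x d ≠ 0) ∧
        (∀ x ∈ X, polyEval k x d ≠ 0 → matRatVal k u d x ∈ V.carrier) ∧
        -- h is PGL_n-equivariant
        (∀ g : GL (Fin n) k, ∀ x ∈ X,
          polyEval k x d ≠ 0 → polyEval k (conjAct k g x) d ≠ 0 →
          matRatVal k u d (conjAct k g x) = V.act g (matRatVal k u d x)) ∧
        -- f and h are defined and mutually inverse on dense open sets
        (∃ v ∈ V.carrier, MvPolynomial.eval v q ≠ 0 ∧ polyEval k (affRatVal k p q v) d ≠ 0) ∧
        (∃ x ∈ X, polyEval k x d ≠ 0 ∧ MvPolynomial.eval (matRatVal k u d x) q ≠ 0) ∧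
        (∀ v ∈ V.carrier, MvPolynomial.eval v q ≠ 0 → polyEval k (affRatVal k p q v) d ≠ 0 →
          matRatVal k u d (affRatVal k p q v) = v) ∧
        (∀ x ∈ X, polyEval k x d ≠ 0 → MvPolynomial.eval (matRatVal k u d x) q ≠ 0 →
          affRatVal k p q (matRatVal k u d x) = x) := by
  obtain ⟨K, _, _, _, ξ, hfix, hξ, hdiv, hact⟩ := exists_funField k V hirr
  obtain ⟨_, ⟨S, rfl⟩, hC, hst⟩ := hfree
  obtain ⟨v1, hv1, hv1S⟩ := Set.not_subset.1 hC
  simp only [Set.mem_setOf_eq, not_forall] at hv1S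
  obtain ⟨p, hpS, hpv⟩ := hv1S
  obtain ⟨m, hm, x, a, u, d, hxg, hax, hd, hu⟩ := alg_main k hn V p
    (fun v hv hpv g hg => hst v hv (fun h => hpv (h p hpS)) g hg) ξ hfix hξ hact
    (fun h0 => hpv ((hξ p).1 h0 v1 hv1))
  exact ⟨m, hm, geom_main k n V ξ hfix hξ hdiv hact m x a u d hxg hax hd hu⟩

end
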